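/- arXiv:0710.4478 — 4 statements merged into one kernel-verified Lean document; each statement's English description precedes it below -/
import Mathlib

section
/- Let M be a von Neumann algebra acting on a complex Hilbert space H, and let D : M → M be a ℂ-linear map satisfying D(xy) = D(x)y + xD(y) for all x, y ∈ M. Then D is continuous with respect to the operator norm on M. -/
open Filter Topology

namespace VonNeumannAlgebra

variable {H : Type*} [NormedAddCommGroup H] [InnerProductSpace ℂ H] [CompleteSpace H]
  (M : VonNeumannAlgebra H)

instance completeSpace_toStarSubalgebra : CompleteSpace M.toStarSubalgebra := by
  have h : IsClosed (M : Set (H →L[ℂ] H)) := by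
    rw [← M.centralizer_centralizer]
    exact Set.isClosed_centralizer _
  exact h.completeSpace_coe

variable {M}

theorem sqrt_mem {a : H →L[ℂ] H} (ha : a ∈ M) : CFC.sqrt a ∈ M := by
  rw [← M.commutant_commutant, mem_commutant_iff]
  intro g hg
  have hc : Commute a g := mem_commutant_iff.1 hg a ha
  exact (hc.cfcₙ_nnreal _).eq.symm

theorem exists_isSelfAdjoint_mul_self_eq {a : M.toStarSubalgebra} (ha : IsSelfAdjoint a) :
    ∃ b : M.toStarSubalgebra, IsSelfAdjoint b ∧ b * b = (‖a‖ ^ 2 : ℂ) • 1 - a * a := by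
  have hpos : 0 ≤ (((‖a‖ ^ 2 : ℂ) • 1 - a * a : M.toStarSubalgebra) : H →L[ℂ] H) := by
    have h := CStarAlgebra.star_mul_le_algebraMap_norm_sq (a := (a : H →L[ℂ] H))
    have hs : star (a : H →L[ℂ] H) = a := congrArg Subtype.val ha.star_eq
    rw [hs, ← sub_nonneg] at h
    convert h using 1
    simp [Algebra.algebraMap_eq_smul_one]
    norm_cast
  refine ⟨⟨_, sqrt_mem (SetLike.coe_mem ((‖a‖ ^ 2 : ℂ) • 1 - a * a))⟩, ?_, ?_⟩
  · exact Subtype.ext (CFC.sqrt_nonneg _).isSelfAdjoint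
  · exact Subtype.ext (CFC.sqrt_mul_sqrt_self _ hpos)

theorem inner_apply_left {a : M.toStarSubalgebra} (ha : IsSelfAdjoint a) (v w : H) :
    inner ℂ ((a : H →L[ℂ] H) v) w = inner ℂ v ((a : H →L[ℂ] H) w) := by
  have hs : IsSelfAdjoint (a : H →L[ℂ] H) := congrArg Subtype.val ha.star_eq
  exact hs.isSymmetric v w

variable {D : M.toStarSubalgebra →ₗ[ℂ] M.toStarSubalgebra}

theorem norm_le_norm_add_derivation
    (hleib : ∀ x y, D (x * y) = D x * y + x * D y) (hstar : ∀ x, D (star x) = star (D x))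
    {a : M.toStarSubalgebra} (ha : IsSelfAdjoint a) : ‖a‖ ≤ ‖a + D a‖ := by
  rcases (norm_nonneg a).eq_or_lt with h0 | h0
  · rw [← h0]; positivity
  obtain ⟨b, hb, hbb⟩ := exists_isSelfAdjoint_mul_self_eq ha
  have hDa : IsSelfAdjoint (D a) := by rw [IsSelfAdjoint, ← hstar, ha.star_eq]
  have hDb : IsSelfAdjoint (D b) := by rw [IsSelfAdjoint, ← hstar, hb.star_eq]
  have hone : D 1 = 0 := by simpa using hleib 1 1
  have hD : D b * b + b * D b = -(D a * a + a * D a) := by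
    rw [← hleib, ← hleib, hbb, map_sub, map_smul, hone, smul_zero, zero_sub]
  have key : ∀ η ∈ Set.Ioo 0 ‖a‖,
      η ^ 2 - 2 * (‖D b‖ * √(‖a‖ ^ 2 - η ^ 2)) ≤ ‖a + D a‖ ^ 2 := by
    rintro η ⟨hη0, hη⟩
    obtain ⟨v, hv, hav⟩ := (a : H →L[ℂ] H).exists_lt_apply_of_lt_opNorm hη
    have hbv : ‖(b : H →L[ℂ] H) v‖ ^ 2 = ‖a‖ ^ 2 * ‖v‖ ^ 2 - ‖(a : H →L[ℂ] H) v‖ ^ 2 := by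
      have h := congrArg (fun c : M.toStarSubalgebra ↦ inner ℂ v ((c : H →L[ℂ] H) v)) hbb
      simp [← inner_apply_left ha, ← inner_apply_left hb,
        inner_self_eq_norm_sq_to_K] at h
      exact_mod_cast h
    have hbv' : ‖(b : H →L[ℂ] H) v‖ ≤ √(‖a‖ ^ 2 - η ^ 2) := by
      apply Real.le_sqrt_of_sq_le
      rw [hbv]
      have h1 : ‖v‖ ^ 2 ≤ 1 := pow_le_one₀ (norm_nonneg v) hv.le
      have h2 : η ^ 2 ≤ ‖(a : H →L[ℂ] H) v‖ ^ 2 := by gcongr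
      nlinarith [sq_nonneg ‖a‖]
    have hre : (inner ℂ ((a : H →L[ℂ] H) v) ((D a : H →L[ℂ] H) v)).re =
        -(inner ℂ ((b : H →L[ℂ] H) v) ((D b : H →L[ℂ] H) v)).re := by
      have h := congrArg (fun c : M.toStarSubalgebra ↦ (inner ℂ ((c : H →L[ℂ] H) v) v).re) hD
      simp only [MulMemClass.coe_mul, AddMemClass.coe_add, NegMemClass.coe_neg,
        add_apply, neg_apply, mul_apply_eq_comp, inner_add_left, inner_neg_left,
        Complex.add_re, Complex.neg_re] at h
      rw [inner_apply_left hDb ((b : H →L[ℂ] H) v) v, inner_apply_left hb ((D b : H →L[ℂ] H) v) v,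
        inner_apply_left hDa ((a : H →L[ℂ] H) v) v,
        inner_apply_left ha ((D a : H →L[ℂ] H) v) v] at h
      have e1 := inner_re_symm (𝕜 := ℂ) ((a : H →L[ℂ] H) v) ((D a : H →L[ℂ] H) v)
      have e2 := inner_re_symm (𝕜 := ℂ) ((b : H →L[ℂ] H) v) ((D b : H →L[ℂ] H) v)
      simp only [RCLike.re_to_complex] at e1 e2
      linarith
    have hDbv : ‖(D b : H →L[ℂ] H) v‖ ≤ ‖D b‖ :=
      (D b : H →L[ℂ] H).unit_le_opNorm v hv.le
    have hin : (inner ℂ ((b : H →L[ℂ] H) v) ((D b : H →L[ℂ] H) v)).re ≤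
        ‖D b‖ * √(‖a‖ ^ 2 - η ^ 2) := by
      refine (re_inner_le_norm (𝕜 := ℂ) _ _).trans ?_
      rw [mul_comm]
      gcongr
    have hsum : ‖(a : H →L[ℂ] H) v + (D a : H →L[ℂ] H) v‖ ≤ ‖a + D a‖ :=
      ((a + D a : M.toStarSubalgebra) : H →L[ℂ] H).unit_le_opNorm v hv.le
    have hsq := norm_add_sq (𝕜 := ℂ) ((a : H →L[ℂ] H) v) ((D a : H →L[ℂ] H) v)
    simp only [RCLike.re_to_complex] at hsq
    have h2 : η ^ 2 ≤ ‖(a : H →L[ℂ] H) v‖ ^ 2 := by gcongr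
    have h3 := pow_le_pow_left₀ (norm_nonneg _) hsum 2
    nlinarith [sq_nonneg ‖(D a : H →L[ℂ] H) v‖]
  have hlim : Tendsto (fun η : ℝ ↦ η ^ 2 - 2 * (‖D b‖ * √(‖a‖ ^ 2 - η ^ 2)))
      (𝓝[<] ‖a‖) (𝓝 (‖a‖ ^ 2)) := by
    have hc : Continuous fun η : ℝ ↦ η ^ 2 - 2 * (‖D b‖ * √(‖a‖ ^ 2 - η ^ 2)) := by fun_prop
    simpa using (hc.tendsto ‖a‖).mono_left nhdsWithin_le_nhds
  have hsq := le_of_tendsto hlim (eventually_of_mem (Ioo_mem_nhdsLT h0) key)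
  exact (sq_le_sq₀ (norm_nonneg _) (norm_nonneg _)).1 hsq

theorem eq_zero_of_tendsto_derivation
    (hleib : ∀ x y, D (x * y) = D x * y + x * D y) (hstar : ∀ x, D (star x) = star (D x))
    {u : ℕ → M.toStarSubalgebra} {y : M.toStarSubalgebra} (hu : ∀ n, IsSelfAdjoint (u n))
    (hu0 : Tendsto u atTop (𝓝 0)) (huy : Tendsto (fun n ↦ D (u n)) atTop (𝓝 y)) : y = 0 := by
  have hy : IsSelfAdjoint y := by
    refine tendsto_nhds_unique huy.star (huy.congr fun n ↦ ?_)
    rw [← hstar, (hu n).star_eq]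
  have key : ∀ t : ℝ, 0 < t → ‖y‖ ≤ t * ‖D y‖ := by
    intro t ht
    have hle : ∀ n, ‖u n - (t : ℂ) • y‖ ≤
        ‖(u n - (t : ℂ) • y) + (t : ℂ) • (D (u n) - (t : ℂ) • D y)‖ := by
      intro n
      rw [← map_smul, ← map_sub, ← LinearMap.smul_apply]
      refine norm_le_norm_add_derivation (D := (t : ℂ) • D) ?_ ?_ ?_
      · intro x z
        simp [hleib]
      · intro x
        simp [hstar]
      · exact (hu n).sub (IsSelfAdjoint.smul (by simp [IsSelfAdjoint]) hy)
    have hlim₁ := hu0.sub_const ((t : ℂ) • y)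
    have hlim₂ := (huy.sub_const ((t : ℂ) • D y)).const_smul (t : ℂ)
    have h := le_of_tendsto_of_tendsto' hlim₁.norm (hlim₁.add hlim₂).norm hle
    rw [smul_sub, zero_sub, ← add_sub_assoc, neg_add_cancel, zero_sub, norm_neg, norm_neg,
      norm_smul, norm_smul, norm_smul, Complex.norm_real, Real.norm_of_nonneg ht.le] at h
    exact le_of_mul_le_mul_left h ht
  have hlim : Tendsto (fun t : ℝ ↦ t * ‖D y‖) (𝓝[>] 0) (𝓝 0) := by
    have hc : Continuous fun t : ℝ ↦ t * ‖D y‖ := by fun_prop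
    simpa using (hc.tendsto 0).mono_left nhdsWithin_le_nhds
  exact norm_le_zero_iff.1 (ge_of_tendsto hlim (eventually_of_mem self_mem_nhdsWithin key))

theorem continuous_of_star_derivation
    (hleib : ∀ x y, D (x * y) = D x * y + x * D y) (hstar : ∀ x, D (star x) = star (D x)) :
    Continuous D := by
  have add_star_eq_zero : ∀ (u : ℕ → M.toStarSubalgebra) (y : M.toStarSubalgebra),
      Tendsto u atTop (𝓝 0) → Tendsto (fun n ↦ D (u n)) atTop (𝓝 y) → y + star y = 0 := by
    intro u y hu0 huy
    refine eq_zero_of_tendsto_derivation hleib hstar (u := fun n ↦ u n + star (u n))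
      (fun n ↦ IsSelfAdjoint.add_star_self _) (by simpa using hu0.add hu0.star) ?_
    simpa only [map_add, hstar] using huy.add huy.star
  refine D.continuous_of_seq_closed_graph fun u x y hux huy ↦ ?_
  rw [← sub_eq_zero]
  have hu0 : Tendsto (fun n ↦ u n - x) atTop (𝓝 0) := by simpa using hux.sub_const x
  have huy' : Tendsto (fun n ↦ D (u n - x)) atTop (𝓝 (y - D x)) := by
    simpa only [map_sub, Function.comp_apply] using huy.sub_const (D x)
  have h₁ := add_star_eq_zero _ _ hu0 huy'
  have h₂ := add_star_eq_zero (fun n ↦ Complex.I • (u n - x)) (Complex.I • (y - D x))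
    (by simpa using hu0.const_smul Complex.I)
    (by simpa only [map_smul] using huy'.const_smul Complex.I)
  generalize y - D x = z at h₁ h₂
  have h₃ : Complex.I • (z - star z) = 0 := by
    rw [smul_sub, sub_eq_add_neg, ← h₂, star_smul]
    simp
  have h₄ : z - star z = 0 := (smul_eq_zero.1 h₃).resolve_left Complex.I_ne_zero
  have h₅ : (2 : ℂ) • z = 0 := by
    rw [two_smul, ← add_zero (0 : M.toStarSubalgebra)]
    nth_rewrite 1 [← h₁]
    rw [← h₄]
    abel
  exact (smul_eq_zero.1 h₅).resolve_left two_ne_zero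

end VonNeumannAlgebra

/-- Every derivation on a von Neumann algebra is continuous
with respect to the operator norm. -/
theorem vonNeumann_derivation_continuous
    {H : Type*} [NormedAddCommGroup H] [InnerProductSpace ℂ H] [CompleteSpace H]
    (M : VonNeumannAlgebra H)
    (D : M.toStarSubalgebra →ₗ[ℂ] M.toStarSubalgebra)
    (hleib : ∀ x y : M.toStarSubalgebra, D (x * y) = D x * y + x * D y) :
    Continuous D := by
  let S : M.toStarSubalgebra →ₗ[ℂ] M.toStarSubalgebra :=
    { toFun := fun x ↦ star (D (star x))
      map_add' := by simp
      map_smul' := by simp }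
  have hS : ∀ x, S x = star (D (star x)) := fun _ ↦ rfl
  have hSleib : ∀ x y, S (x * y) = S x * y + x * S y := by
    intro x y
    simp only [hS, star_mul, hleib, star_add, star_star]
    abel
  have h₁ : Continuous (D + S) := by
    refine VonNeumannAlgebra.continuous_of_star_derivation (fun x y ↦ ?_) (fun x ↦ ?_)
    · simp only [LinearMap.add_apply, hleib, hSleib]
      noncomm_ring
    · rw [LinearMap.add_apply, LinearMap.add_apply, hS, hS, star_star, star_add, star_star,
        add_comm]
  have h₂ : Continuous (Complex.I • (D - S)) := by
    refine VonNeumannAlgebra.continuous_of_star_derivation (fun x y ↦ ?_) (fun x ↦ ?_)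
    · simp only [LinearMap.smul_apply, LinearMap.sub_apply, hleib, hSleib, smul_mul_assoc,
        mul_smul_comm, ← smul_add]
      congr 1
      noncomm_ring
    · simp [hS, smul_sub, neg_add_eq_sub]
  have hD : ⇑D = fun x ↦ (2⁻¹ : ℂ) • ((D + S) x - Complex.I • (Complex.I • (D - S)) x) := by
    funext x
    simp only [LinearMap.smul_apply, LinearMap.sub_apply, LinearMap.add_apply, smul_smul,
      Complex.I_mul_I]
    module
  rw [hD]
  exact (h₁.sub (h₂.const_smul Complex.I)).const_smul (2⁻¹ : ℂ)
end

section
/- Let (Ω, Σ, μ) be a measure space and let L⁰(Ω) denote the commutative ℂ-algebra of equivalence classes (modulo equality μ-almost everywhere) of measurable complex-valued functions on Ω, with pointwise operations. Let A be a ℂ-subalgebra of L⁰(Ω) containing the class of every essentially bounded measurable function, and let D : A → A be a ℂ-linear map satisfying D(fg) = D(f)g + fD(g) for all f, g ∈ A. If D(f) = 0 for every essentially bounded element f of A, then D(x) = 0 for every x ∈ A. -/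
open MeasureTheory

/-- Let `A` be a `ℂ`-subalgebra of `L⁰(Ω)` (the algebra of
a.e.-equivalence classes of measurable complex functions) containing the class
of every essentially bounded function, and let `D` be a derivation on `A`.
If `D` vanishes on every essentially bounded element of `A`, then `D` is
identically zero on `A`. -/
theorem derivation_zero_of_vanishes_on_bounded
    {Ω : Type*} [MeasurableSpace Ω] (μ : Measure Ω)
    (A : Set (Ω →ₘ[μ] ℂ))
    (hadd_mem : ∀ f ∈ A, ∀ g ∈ A, f + g ∈ A)
    (hmul_mem : ∀ f ∈ A, ∀ g ∈ A, f * g ∈ A)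
    (hsmul_mem : ∀ (c : ℂ), ∀ f ∈ A, c • f ∈ A)
    (hbdd : ∀ f : Ω →ₘ[μ] ℂ, (∃ C : ℝ, ∀ᵐ ω ∂μ, ‖f ω‖ ≤ C) → f ∈ A)
    (D : (Ω →ₘ[μ] ℂ) → (Ω →ₘ[μ] ℂ))
    (hmap : ∀ f ∈ A, D f ∈ A)
    (hadd : ∀ f ∈ A, ∀ g ∈ A, D (f + g) = D f + D g)
    (hsmul : ∀ (c : ℂ), ∀ f ∈ A, D (c • f) = c • D f)
    (hleib : ∀ f ∈ A, ∀ g ∈ A, D (f * g) = D f * g + f * D g)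
    (hvanish : ∀ f ∈ A, (∃ C : ℝ, ∀ᵐ ω ∂μ, ‖f ω‖ ≤ C) → D f = 0) :
    ∀ f ∈ A, D f = 0 := by
  intro f hf
  have hcont : Continuous fun z : ℂ => (((1 + ‖z‖)⁻¹ : ℝ) : ℂ) := by
    refine Complex.continuous_ofReal.comp (Continuous.inv₀ (by fun_prop) fun z => ?_)
    positivity
  set g : Ω →ₘ[μ] ℂ := AEEqFun.comp _ hcont f
  have hg : ∀ᵐ ω ∂μ, g ω = (((1 + ‖f ω‖)⁻¹ : ℝ) : ℂ) := AEEqFun.coeFn_comp _ hcont f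
  have hnorm : ∀ z : ℂ, ‖(((1 + ‖z‖)⁻¹ : ℝ) : ℂ)‖ = (1 + ‖z‖)⁻¹ := fun z => by
    rw [Complex.norm_real, Real.norm_of_nonneg (by positivity)]
  have hg_bdd : ∃ C : ℝ, ∀ᵐ ω ∂μ, ‖g ω‖ ≤ C := by
    refine ⟨1, ?_⟩
    filter_upwards [hg] with ω h
    rw [h, hnorm]
    exact inv_le_one_of_one_le₀ (by linarith [norm_nonneg (f ω)])
  have hfg_bdd : ∃ C : ℝ, ∀ᵐ ω ∂μ, ‖(f * g) ω‖ ≤ C := by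
    refine ⟨1, ?_⟩
    filter_upwards [hg, AEEqFun.coeFn_mul f g] with ω h hmul
    rw [hmul, Pi.mul_apply, norm_mul, h, hnorm, ← div_eq_mul_inv]
    exact div_le_one_of_le₀ (by linarith) (by positivity)
  have hgA : g ∈ A := hbdd g hg_bdd
  have hmul_zero : D f * g = 0 := by
    have h := hleib f hf g hgA
    rw [hvanish _ (hbdd _ hfg_bdd) hfg_bdd, hvanish g hgA hg_bdd] at h
    have hf_zero : f * 0 = 0 := by
      apply AEEqFun.ext
      filter_upwards [AEEqFun.coeFn_mul f 0,
        AEEqFun.coeFn_zero (α := Ω) (β := ℂ) (μ := μ)] with ω hmul hz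
      rw [hmul, Pi.mul_apply, hz, Pi.zero_apply, mul_zero]
    rw [hf_zero, add_zero] at h
    exact h.symm
  apply AEEqFun.ext
  have hzero : ∀ᵐ ω ∂μ, (D f * g) ω = 0 := by
    rw [hmul_zero]
    exact AEEqFun.coeFn_zero
  filter_upwards [hg, hzero, AEEqFun.coeFn_mul (D f) g,
    AEEqFun.coeFn_zero (α := Ω) (β := ℂ) (μ := μ)] with ω h h0 hmul hz
  rw [hmul, Pi.mul_apply] at h0
  have hne : g ω ≠ 0 := by
    rw [h, ← norm_ne_zero_iff, hnorm]
    positivity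
  rw [hz, (mul_eq_zero.mp h0).resolve_right hne, Pi.zero_apply]
end

section
/- Let (Ω, Σ, μ) be a measure space, let L⁰(Ω) denote the commutative ℂ-algebra of equivalence classes (modulo equality μ-almost everywhere) of measurable complex-valued functions on Ω with pointwise operations, and let A be a ℂ-subalgebra of L⁰(Ω) containing the class of every essentially bounded measurable function. Let D : A → A be a ℂ-linear map satisfying D(fg) = D(f)g + fD(g) for all f, g ∈ A, and suppose the restriction of D to the essentially bounded elements is continuous from the essential supremum norm into convergence in measure: for every sequence (f_n) of essentially bounded elements with ‖f_n‖_∞ → 0, the sequence D(f_n) converges to 0 in measure. Then D is identically zero on A. -/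
open MeasureTheory Filter Topology

section Derivation

variable {Ω : Type*} [MeasurableSpace Ω] {μ : Measure Ω}

/-- Rounds the real and imaginary parts down to multiples of `1 / c`. -/
noncomputable def gridRound (c : ℝ) (z : ℂ) : ℂ :=
  ⟨(⌊c * z.re⌋ : ℝ) / c, (⌊c * z.im⌋ : ℝ) / c⟩

lemma abs_sub_floor_div_le {c : ℝ} (hc : 0 < c) (x : ℝ) :
    |x - (⌊c * x⌋ : ℝ) / c| ≤ 1 / c := by
  have hx : x - (⌊c * x⌋ : ℝ) / c = Int.fract (c * x) / c := by
    rw [← Int.self_sub_floor]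
    field_simp
  rw [hx, abs_of_nonneg (div_nonneg (Int.fract_nonneg _) hc.le)]
  gcongr
  exact (Int.fract_lt_one _).le

lemma norm_sub_gridRound_le {c : ℝ} (hc : 0 < c) (z : ℂ) :
    ‖z - gridRound c z‖ ≤ 2 / c := by
  refine (Complex.norm_le_abs_re_add_abs_im _).trans ?_
  have hre := abs_sub_floor_div_le hc z.re
  have him := abs_sub_floor_div_le hc z.im
  have htwo : 2 / c = 1 / c + 1 / c := by ring
  rw [htwo]
  exact add_le_add hre him

lemma measurable_gridRound (c : ℝ) : Measurable (gridRound c) := by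
  have h : gridRound c = fun z : ℂ =>
      (((⌊c * z.re⌋ : ℝ) / c : ℝ) : ℂ) + (((⌊c * z.im⌋ : ℝ) / c : ℝ) : ℂ) * Complex.I := by
    funext z
    exact (Complex.mk_eq_add_mul_I _ _)
  rw [h]
  fun_prop

lemma countable_range_gridRound (c : ℝ) : (Set.range (gridRound c)).Countable := by
  refine (Set.countable_range fun p : ℤ × ℤ => (⟨(p.1 : ℝ) / c, (p.2 : ℝ) / c⟩ : ℂ)).mono ?_
  rintro _ ⟨z, rfl⟩
  exact ⟨(⌊c * z.re⌋, ⌊c * z.im⌋), rfl⟩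

/-- A map satisfying the Leibniz rule at an idempotent of a commutative ring vanishes there. -/
lemma eq_zero_of_leibniz_of_idempotent {R : Type*} [CommRing R] {e d : R}
    (he : e * e = e) (hd : d = d * e + e * d) : d = 0 := by
  linear_combination (1 - 2 * e) * hd - 4 * d * he

/-- A derivation on an algebra of measurable functions containing the bounded ones vanishes on
functions with countable range. -/
lemma derivation_mk_eq_zero_of_countable_range
    {A : Set (Ω →ₘ[μ] ℂ)}
    (hbdd : ∀ f : Ω →ₘ[μ] ℂ, (∃ C : ℝ, ∀ᵐ ω ∂μ, ‖f ω‖ ≤ C) → f ∈ A)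
    {D : (Ω →ₘ[μ] ℂ) → (Ω →ₘ[μ] ℂ)}
    (hsmul : ∀ (c : ℂ), ∀ f ∈ A, D (c • f) = c • D f)
    (hleib : ∀ f ∈ A, ∀ g ∈ A, D (f * g) = D f * g + f * D g)
    {h : Ω → ℂ} (hm : Measurable h) (hc : (Set.range h).Countable)
    (hA : AEEqFun.mk h hm.aestronglyMeasurable ∈ A) :
    D (AEEqFun.mk h hm.aestronglyMeasurable) = 0 := by
  have key : ∀ q ∈ Set.range h, ∀ᵐ ω ∂μ, h ω = q →
      D (AEEqFun.mk h hm.aestronglyMeasurable) ω = 0 := by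
    intro q _
    have hind : Measurable ((h ⁻¹' {q}).indicator (fun _ => (1 : ℂ))) :=
      measurable_const.indicator (hm (measurableSet_singleton q))
    set e : Ω →ₘ[μ] ℂ := AEEqFun.mk _ hind.aestronglyMeasurable
    have hecoe : ⇑e =ᵐ[μ] (h ⁻¹' {q}).indicator (fun _ => (1 : ℂ)) := AEEqFun.coeFn_mk _ _
    have heA : e ∈ A := by
      refine hbdd e ⟨1, ?_⟩
      filter_upwards [hecoe] with ω hω
      rw [hω]
      by_cases hq : ω ∈ h ⁻¹' {q} <;> simp [hq]
    have hee : e * e = e := by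
      apply AEEqFun.ext
      filter_upwards [hecoe, AEEqFun.coeFn_mul e e] with ω hω hmul
      rw [hmul, Pi.mul_apply, hω]
      by_cases hq : ω ∈ h ⁻¹' {q} <;> simp [hq]
    have hDe : D e = 0 := by
      have hD := hleib e heA e heA
      rw [hee] at hD
      apply AEEqFun.ext
      filter_upwards [AEEqFun.coeFn_mul e e, AEEqFun.coeFn_add (D e * e) (e * D e),
        AEEqFun.coeFn_mul (D e) e, AEEqFun.coeFn_mul e (D e),
        AEEqFun.coeFn_zero (α := Ω) (β := ℂ) (μ := μ)] with ω h₁ h₂ h₃ h₄ h₀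
      rw [hee] at h₁
      rw [← hD, Pi.add_apply, h₃, h₄] at h₂
      rw [h₀]
      exact eq_zero_of_leibniz_of_idempotent h₁.symm h₂
    have heh : e * AEEqFun.mk h hm.aestronglyMeasurable = q • e := by
      apply AEEqFun.ext
      filter_upwards [hecoe, AEEqFun.coeFn_mul e (AEEqFun.mk h hm.aestronglyMeasurable),
        AEEqFun.coeFn_smul q e, AEEqFun.coeFn_mk h (hm.aestronglyMeasurable (μ := μ))]
        with ω hω hmul hsm hh
      rw [hmul, hsm, Pi.mul_apply, Pi.smul_apply, hω, hh]
      by_cases hq : h ω = q <;> simp [hq]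
    have hzero : e * D (AEEqFun.mk h hm.aestronglyMeasurable) = 0 := by
      have hD := hleib e heA _ hA
      rw [heh, hsmul q e heA, hDe] at hD
      set g := AEEqFun.mk h hm.aestronglyMeasurable
      apply AEEqFun.ext
      filter_upwards [AEEqFun.coeFn_smul q (0 : Ω →ₘ[μ] ℂ), AEEqFun.coeFn_add (0 * g) (e * D g),
        AEEqFun.coeFn_mul 0 g,
        AEEqFun.coeFn_zero (α := Ω) (β := ℂ) (μ := μ)] with ω h₁ h₂ h₃ h₀
      rw [← hD, h₁, Pi.add_apply, h₃, Pi.smul_apply, Pi.mul_apply, h₀] at h₂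
      rw [h₀]
      simpa using h₂.symm
    filter_upwards [hecoe, AEEqFun.coeFn_mul e (D (AEEqFun.mk h hm.aestronglyMeasurable)),
      AEEqFun.coeFn_zero (α := Ω) (β := ℂ) (μ := μ)] with ω hω hmul h0 hq
    rw [hzero, h0, Pi.mul_apply, hω] at hmul
    simpa [hq] using hmul.symm
  apply AEEqFun.ext
  filter_upwards [(ae_ball_iff hc).2 key, AEEqFun.coeFn_zero (α := Ω) (β := ℂ) (μ := μ)]
    with ω hω h0
  rw [h0]
  exact hω _ ⟨ω, rfl⟩ rfl

/-- If a constant sequence converges to zero in measure, its term is zero. -/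
lemma eq_zero_of_tendstoInMeasure_const {f : Ω →ₘ[μ] ℂ}
    (hf : TendstoInMeasure μ (fun _ : ℕ => ⇑f) atTop 0) : f = 0 := by
  obtain ⟨ns, -, hns⟩ := hf.exists_seq_tendsto_ae
  apply AEEqFun.ext
  filter_upwards [hns, AEEqFun.coeFn_zero (α := Ω) (β := ℂ) (μ := μ)] with ω hω h0
  rw [h0]
  exact tendsto_nhds_unique tendsto_const_nhds hω

end Derivation

/-- Let `A` be a `ℂ`-subalgebra of `L⁰(Ω)` containing the
class of every essentially bounded function, and let `D` be a derivation on
`A` whose restriction to the essentially bounded elements is continuous from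
the essential supremum norm into convergence in measure. Then `D` is
identically zero on `A`. -/
theorem derivation_zero_of_continuous_on_bounded
    {Ω : Type*} [MeasurableSpace Ω] (μ : Measure Ω)
    (A : Set (Ω →ₘ[μ] ℂ))
    (hadd_mem : ∀ f ∈ A, ∀ g ∈ A, f + g ∈ A)
    (hmul_mem : ∀ f ∈ A, ∀ g ∈ A, f * g ∈ A)
    (hsmul_mem : ∀ (c : ℂ), ∀ f ∈ A, c • f ∈ A)
    (hbdd : ∀ f : Ω →ₘ[μ] ℂ, (∃ C : ℝ, ∀ᵐ ω ∂μ, ‖f ω‖ ≤ C) → f ∈ A)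
    (D : (Ω →ₘ[μ] ℂ) → (Ω →ₘ[μ] ℂ))
    (hmap : ∀ f ∈ A, D f ∈ A)
    (hadd : ∀ f ∈ A, ∀ g ∈ A, D (f + g) = D f + D g)
    (hsmul : ∀ (c : ℂ), ∀ f ∈ A, D (c • f) = c • D f)
    (hleib : ∀ f ∈ A, ∀ g ∈ A, D (f * g) = D f * g + f * D g)
    (hcont : ∀ f : ℕ → (Ω →ₘ[μ] ℂ), (∀ n, f n ∈ A) →
      (∀ n, ∃ C : ℝ, ∀ᵐ ω ∂μ, ‖f n ω‖ ≤ C) →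
      Tendsto (fun n => eLpNorm (f n) ⊤ μ) atTop (𝓝 0) →
      TendstoInMeasure μ (fun n => ⇑(D (f n))) atTop 0) :
    ∀ f ∈ A, D f = 0 := by
  intro f hf
  let h : ℕ → Ω → ℂ := fun n ω => gridRound (n + 1 : ℝ) (f ω)
  have hm : ∀ n, Measurable (h n) := fun n =>
    (measurable_gridRound _).comp f.stronglyMeasurable.measurable
  have hcount : ∀ n, (Set.range (h n)).Countable := fun n =>
    (countable_range_gridRound _).mono (Set.range_comp_subset_range f (gridRound (n + 1 : ℝ)))
  let F : ℕ → (Ω →ₘ[μ] ℂ) := fun n => AEEqFun.mk (h n) (hm n).aestronglyMeasurable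
  have hbound : ∀ n, ∀ᵐ ω ∂μ, ‖(f - F n) ω‖ ≤ 2 / (n + 1 : ℝ) := by
    intro n
    filter_upwards [AEEqFun.coeFn_sub f (F n),
      AEEqFun.coeFn_mk (h n) ((hm n).aestronglyMeasurable (μ := μ))] with ω hsub hmk
    rw [hsub, Pi.sub_apply, hmk]
    exact norm_sub_gridRound_le (by positivity) _
  have hdiff : ∀ n, f - F n ∈ A := fun n => hbdd _ ⟨_, hbound n⟩
  have hFA : ∀ n, F n ∈ A := by
    intro n
    have hneg : F n - f ∈ A := by
      refine hbdd _ ⟨2 / (n + 1 : ℝ), ?_⟩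
      filter_upwards [hbound n, AEEqFun.coeFn_sub f (F n), AEEqFun.coeFn_sub (F n) f]
        with ω hω h₁ h₂
      rwa [h₂, Pi.sub_apply, norm_sub_rev, ← Pi.sub_apply, ← h₁]
    have := hadd_mem f hf _ hneg
    rwa [add_sub_cancel] at this
  have hDdiff : ∀ n, D (f - F n) = D f := by
    intro n
    have hF : D (F n) = 0 :=
      derivation_mk_eq_zero_of_countable_range hbdd hsmul hleib (hm n) (hcount n) (hFA n)
    have := hadd _ (hdiff n) _ (hFA n)
    rwa [sub_add_cancel, hF, add_zero, eq_comm] at this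
  have hlim : Tendsto (fun n => eLpNorm (f - F n) ⊤ μ) atTop (𝓝 0) := by
    have hto : Tendsto (fun n : ℕ => ENNReal.ofReal (2 / (n + 1 : ℝ))) atTop (𝓝 0) := by
      have := (tendsto_one_div_add_atTop_nhds_zero_nat (𝕜 := ℝ)).const_mul 2
      simpa only [mul_one_div, mul_zero, ENNReal.ofReal_zero] using ENNReal.tendsto_ofReal this
    refine tendsto_of_tendsto_of_tendsto_of_le_of_le tendsto_const_nhds hto
      (fun _ => zero_le) fun n => ?_
    simpa only [eLpNorm_exponent_top] using eLpNormEssSup_le_of_ae_bound (hbound n)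
  have := hcont (fun n => f - F n) hdiff (fun n => ⟨_, hbound n⟩) hlim
  simp only [hDdiff] at this
  exact eq_zero_of_tendstoInMeasure_const this
end

section
/- For each n ∈ ℕ, let H_n be a complex Hilbert space and let M_n ⊆ B(H_n) be a von Neumann algebra, with operator norm ‖·‖_{M_n}. Let A = { (x_n)_{n∈ℕ} : x_n ∈ M_n for all n, and for every real p with 1 ≤ p < ∞ the series ∑_{n=1}^∞ 2^{-n} ‖x_n‖_{M_n}^p converges }, a *-subalgebra of the product ∏_n M_n under coordinatewise operations and involution. Then every ℂ-linear map D : A → A satisfying D(xy) = D(x)y + xD(y) for all x, y ∈ A is inner: there exists a = (a_n) ∈ A such that D(x) = ax - xa (coordinatewise) for every x ∈ A. -/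
section

open scoped ContDiff FourierTransform
open MeasureTheory Filter Topology

/-- Smooth compactly supported complex functions on the line. -/
def IsTestFunction (g : ℝ → ℂ) : Prop := ContDiff ℝ ∞ g ∧ HasCompactSupport g

namespace IsTestFunction

variable {g h : ℝ → ℂ}

lemma continuous (hg : IsTestFunction g) : Continuous g := hg.1.continuous

lemma integrable (hg : IsTestFunction g) : Integrable g :=
  hg.continuous.integrable_of_hasCompactSupport hg.2

lemma differentiable (hg : IsTestFunction g) : Differentiable ℝ g :=
  hg.1.differentiable (by simp)

lemma deriv (hg : IsTestFunction g) : IsTestFunction (deriv g) :=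
  ⟨(contDiff_infty_iff_deriv.1 hg.1).2, hg.2.deriv⟩

lemma mul_left {m : ℝ → ℂ} (hg : IsTestFunction g) (hm : ContDiff ℝ ∞ m) :
    IsTestFunction (fun l => m l * g l) :=
  ⟨hm.mul hg.1, hg.2.mul_left⟩

lemma sub (hg : IsTestFunction g) (hh : IsTestFunction h) : IsTestFunction (fun l => g l - h l) :=
  ⟨hg.1.sub hh.1, hg.2.sub hh.2⟩

lemma integrable_fourier (hg : IsTestFunction g) : Integrable (𝓕 g) :=
  (𝓕 (hg.2.toSchwartzMap hg.1)).integrable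

lemma continuous_fourier (hg : IsTestFunction g) : Continuous (𝓕 g) :=
  (𝓕 (hg.2.toSchwartzMap hg.1)).continuous

lemma integral_fourier (hg : IsTestFunction g) : ∫ r, 𝓕 g r = g 0 := by
  have h := hg.continuous.fourierInv_fourier_eq hg.integrable hg.integrable_fourier
  simpa [Real.fourierInv_eq] using congrFun h 0

lemma contDiff_ofReal : ContDiff ℝ ∞ (fun l : ℝ => (l : ℂ)) := Complex.ofRealCLM.contDiff

lemma contDiff_sub_pow (c : ℝ) (n : ℕ) : ContDiff ℝ ∞ (fun l : ℝ => ((l : ℂ) - c) ^ n) :=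
  (contDiff_ofReal.sub contDiff_const).pow n

/-- Multiplication by a power of `l - c`. -/
lemma sub_pow_mul (hg : IsTestFunction g) (c : ℝ) (n : ℕ) :
    IsTestFunction (fun l => ((l : ℂ) - c) ^ n * g l) :=
  hg.mul_left (contDiff_sub_pow c n)

lemma hasDerivAt_fourier (hg : IsTestFunction g) (r : ℝ) :
    HasDerivAt (𝓕 g) ((-2 * Real.pi * Complex.I) * 𝓕 (fun l : ℝ => (l : ℂ) * g l) r) r := by
  have hi : Integrable (fun l : ℝ => l • g l) := by
    simpa using (hg.mul_left contDiff_ofReal).integrable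
  refine (Real.hasDerivAt_fourier hg.integrable hi r).congr_deriv ?_
  rw [Real.fourier_eq, Real.fourier_eq, ← integral_const_mul]
  congr 1
  ext v
  simp only [Circle.smul_def, smul_eq_mul]
  ring

/-- Powers of `l - c` against a test function supported in the interval of radius `ρ` around `c`. -/
lemma norm_fourier_sub_pow_mul_le (hg : IsTestFunction g) {c ρ : ℝ}
    (hs : ∀ l, g l ≠ 0 → |l - c| ≤ ρ) (n : ℕ) (r : ℝ) :
    ‖𝓕 (fun l : ℝ => ((l : ℂ) - c) ^ n * g l) r‖ ≤ ρ ^ n * ∫ l, ‖g l‖ := by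
  rw [Real.fourier_eq, ← integral_const_mul]
  refine norm_integral_le_of_norm_le (hg.integrable.norm.const_mul _) (ae_of_all _ fun l => ?_)
  rw [Circle.norm_smul, norm_mul, norm_pow]
  by_cases hl : g l = 0
  · simp [hl]
  · have : ‖(l : ℂ) - c‖ = |l - c| := by
      rw [← Complex.ofReal_sub, Complex.norm_real, Real.norm_eq_abs]
    rw [this]
    gcongr
    exact hs l hl

lemma deriv_sub_pow_mul (hg : IsTestFunction g) (c : ℝ) (n : ℕ) :
    _root_.deriv (fun l : ℝ => ((l : ℂ) - c) ^ n * g l) =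
      fun l : ℝ => (n : ℂ) * (((l : ℂ) - c) ^ (n - 1) * g l) +
        ((l : ℂ) - c) ^ n * _root_.deriv g l := by
  ext l
  have h1 : HasDerivAt (fun l : ℝ => ((l : ℂ) - c)) 1 l :=
    (Complex.ofRealCLM.hasDerivAt (x := l)).sub_const _
  have h2 := (h1.pow n).mul (hg.differentiable l).hasDerivAt
  refine (h2.congr_deriv ?_).deriv
  simp
  ring

lemma fourier_deriv_eq (hg : IsTestFunction g) (r : ℝ) :
    𝓕 (_root_.deriv g) r = 2 * Real.pi * Complex.I * r * 𝓕 g r := by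
  simpa using congrFun (Real.fourier_deriv hg.integrable hg.differentiable hg.deriv.integrable) r

lemma fourier_mul_add (hg : IsTestFunction g) (hh : IsTestFunction h) (a : ℂ) (r : ℝ) :
    𝓕 (fun l => a * g l + h l) r = a * 𝓕 g r + 𝓕 h r := by
  have h1 : Integrable fun l : ℝ => Real.fourierChar (-(l * r)) • (a * g l) := by
    simpa [mul_comm] using (Real.fourierIntegral_convergent_iff (μ := volume) r).2 (hg.integrable.const_mul a)
  have h2 : Integrable fun l : ℝ => Real.fourierChar (-(l * r)) • h l := by
    simpa [mul_comm] using (Real.fourierIntegral_convergent_iff (μ := volume) r).2 hh.integrable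
  simp only [Real.fourier_real_eq, smul_add]
  rw [integral_add h1 h2, ← integral_const_mul]
  congr 2
  ext l
  simp only [Circle.smul_def, smul_eq_mul]
  ring

lemma deriv_support {c ρ : ℝ} (hs : ∀ l, g l ≠ 0 → |l - c| ≤ ρ) (l : ℝ)
    (hl : _root_.deriv g l ≠ 0) : |l - c| ≤ ρ := by
  have h1 : tsupport g ⊆ Metric.closedBall c ρ :=
    closure_minimal (fun l hl => by simpa [Real.dist_eq] using hs l hl) Metric.isClosed_closedBall
  simpa [Real.dist_eq] using h1 (support_deriv_subset hl)

lemma exists_abs_pow_mul_norm_fourier_le {c ρ : ℝ} (hρ : 0 < ρ) (k : ℕ) :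
    ∀ g : ℝ → ℂ, IsTestFunction g → (∀ l, g l ≠ 0 → |l - c| ≤ ρ) → ∃ A : ℝ, 0 ≤ A ∧
      ∀ (n : ℕ) (r : ℝ), |r| ^ k * ‖𝓕 (fun l : ℝ => ((l : ℂ) - c) ^ n * g l) r‖ ≤
        A * (n + 1) ^ k * ρ ^ n := by
  induction k with
  | zero =>
    intro g hg hs
    refine ⟨∫ l, ‖g l‖, by positivity, fun n r => ?_⟩
    have := hg.norm_fourier_sub_pow_mul_le hs n r
    simpa [mul_comm] using this
  | succ k ih =>
    intro g hg hs
    obtain ⟨A, hA, h1⟩ := ih g hg hs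
    obtain ⟨B, hB, h2⟩ := ih (_root_.deriv g) hg.deriv (deriv_support hs)
    refine ⟨A / ρ + B, by positivity, fun n r => ?_⟩
    have e1 := (hg.sub_pow_mul c n).fourier_deriv_eq r
    rw [hg.deriv_sub_pow_mul c n,
      (hg.sub_pow_mul c (n - 1)).fourier_mul_add (hg.deriv.sub_pow_mul c n)] at e1
    set G := 𝓕 (fun l : ℝ => ((l : ℂ) - c) ^ n * g l) r
    set G' := 𝓕 (fun l : ℝ => ((l : ℂ) - c) ^ (n - 1) * g l) r with hG'
    set G₂ := 𝓕 (fun l : ℝ => ((l : ℂ) - c) ^ n * _root_.deriv g l) r with hG₂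
    have e2 : |r| * ‖G‖ ≤ n * ‖G'‖ + ‖G₂‖ := by
      have e3 : ‖2 * Real.pi * Complex.I * r * G‖ ≤ n * ‖G'‖ + ‖G₂‖ := by
        rw [← e1]
        refine (norm_add_le _ _).trans ?_
        simp
      have e4 : ‖2 * Real.pi * Complex.I * r * G‖ = 2 * Real.pi * (|r| * ‖G‖) := by
        simp [abs_of_pos Real.pi_pos]
        ring
      rw [e4] at e3
      have := Real.two_le_pi
      nlinarith [mul_nonneg (abs_nonneg r) (norm_nonneg G)]
    have e5 : (n : ℝ) * (|r| ^ k * ‖G'‖) ≤ A / ρ * (n + 1) ^ (k + 1) * ρ ^ n := by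
      rcases n with _ | n
      · simp; positivity
      · have := h1 n r
        simp only [Nat.add_sub_cancel] at hG'
        rw [← hG'] at this
        calc ((n + 1 : ℕ) : ℝ) * (|r| ^ k * ‖G'‖)
            ≤ ((n + 1 : ℕ) : ℝ) * (A * (n + 1) ^ k * ρ ^ n) := by gcongr
          _ = A / ρ * (n + 1) ^ (k + 1) * ρ ^ (n + 1) := by
            push_cast; field_simp; ring
          _ ≤ _ := by push_cast; gcongr; simp
    have e6 := h2 n r
    rw [← hG₂] at e6
    have e7 : (n + 1 : ℝ) ^ k ≤ (n + 1 : ℝ) ^ (k + 1) :=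
      pow_le_pow_right₀ (by simp) (Nat.le_succ k)
    calc |r| ^ (k + 1) * ‖G‖ = |r| ^ k * (|r| * ‖G‖) := by ring
      _ ≤ |r| ^ k * (n * ‖G'‖ + ‖G₂‖) := by gcongr
      _ = n * (|r| ^ k * ‖G'‖) + |r| ^ k * ‖G₂‖ := by ring
      _ ≤ A / ρ * (n + 1) ^ (k + 1) * ρ ^ n + B * (n + 1) ^ (k + 1) * ρ ^ n := by
        refine add_le_add e5 (e6.trans ?_)
        gcongr
      _ = _ := by ring

lemma exists_integral_norm_fourier_le (hg : IsTestFunction g) {c ρ ρ' : ℝ} (hρ : 0 < ρ)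
    (hρ' : ρ < ρ') (hs : ∀ l, g l ≠ 0 → |l - c| ≤ ρ) :
    ∃ A : ℝ, ∀ n : ℕ, ∫ r, ‖𝓕 (fun l : ℝ => ((l : ℂ) - c) ^ n * g l) r‖ ≤ A * ρ' ^ n := by
  obtain ⟨A, hA, h0⟩ := exists_abs_pow_mul_norm_fourier_le hρ 0 g hg hs
  obtain ⟨B, hB, h2⟩ := exists_abs_pow_mul_norm_fourier_le hρ 2 g hg hs
  have hpos : 0 < ρ' := hρ.trans hρ'
  have hlim := tendsto_pow_const_mul_const_pow_of_abs_lt_one 2 (r := ρ / ρ')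
    (by rw [abs_of_pos (by positivity)]; exact (div_lt_one hpos).2 hρ')
  obtain ⟨D, hD⟩ := hlim.bddAbove_range
  have hD' (n : ℕ) : (n + 1 : ℝ) ^ 2 * ρ ^ n ≤ D * (ρ' / ρ) * ρ' ^ n := by
    have : ((n + 1 : ℕ) : ℝ) ^ 2 * (ρ / ρ') ^ (n + 1) ≤ D := hD ⟨n + 1, rfl⟩
    push_cast at this
    calc (n + 1 : ℝ) ^ 2 * ρ ^ n = ((n + 1 : ℝ) ^ 2 * (ρ / ρ') ^ (n + 1)) * (ρ' / ρ) * ρ' ^ n := by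
          rw [div_pow]; field_simp; ring
      _ ≤ _ := by gcongr
  refine ⟨(A + B) * (D * (ρ' / ρ)) * Real.pi, fun n => ?_⟩
  have hb (r : ℝ) : ‖𝓕 (fun l : ℝ => ((l : ℂ) - c) ^ n * g l) r‖ ≤
      (A + B) * (D * (ρ' / ρ)) * ρ' ^ n * (1 + r ^ 2)⁻¹ := by
    rw [← div_eq_mul_inv, le_div_iff₀ (by positivity)]
    have k0 := h0 n r
    have k2 := h2 n r
    rw [sq_abs] at k2
    have k3 : A * ρ ^ n ≤ A * ((n + 1 : ℝ) ^ 2 * ρ ^ n) := by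
      have : (1 : ℝ) ≤ (n + 1 : ℝ) ^ 2 := one_le_pow₀ (by simp)
      have h' : 0 < ρ ^ n := by positivity
      gcongr
      nlinarith
    have k4 := mul_le_mul_of_nonneg_left (hD' n) (add_nonneg hA hB)
    simp only [pow_zero, one_mul, mul_one] at k0
    nlinarith
  calc ∫ r, ‖𝓕 (fun l : ℝ => ((l : ℂ) - c) ^ n * g l) r‖
      ≤ ∫ r : ℝ, (A + B) * (D * (ρ' / ρ)) * ρ' ^ n * (1 + r ^ 2)⁻¹ :=
        integral_mono (hg.sub_pow_mul c n).integrable_fourier.norm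
          (integrable_inv_one_add_sq.const_mul _) hb
    _ = _ := by rw [integral_const_mul, integral_univ_inv_one_add_sq]; ring

end IsTestFunction

section BoundedGroup

variable {E : Type*} [NormedAddCommGroup E] [NormedSpace ℂ E] [CompleteSpace E]

/-- The one-parameter group `r ↦ exp (2 π i r T)`. -/
noncomputable def expGroup (T : E →L[ℂ] E) (r : ℝ) : E →L[ℂ] E :=
  NormedSpace.exp (r • ((2 * Real.pi * Complex.I : ℂ) • T))

omit [CompleteSpace E] in
lemma expGroup_zero (T : E →L[ℂ] E) : expGroup T 0 = 1 := by simp [expGroup]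

lemma hasDerivAt_expGroup (T : E →L[ℂ] E) (r : ℝ) :
    HasDerivAt (expGroup T) (((2 * Real.pi * Complex.I : ℂ) • T) * expGroup T r) r :=
  hasDerivAt_exp_smul_const' (𝕂 := ℝ) ((2 * Real.pi * Complex.I : ℂ) • T) r

lemma hasDerivAt_expGroup_apply (T : E →L[ℂ] E) (x : E) (r : ℝ) :
    HasDerivAt (fun r => expGroup T r x) ((2 * Real.pi * Complex.I : ℂ) • T (expGroup T r x)) r := by
  have h : HasFDerivAt (fun S : E →L[ℂ] E => S x)
      ((ContinuousLinearMap.apply ℂ E x).restrictScalars ℝ) (expGroup T r) :=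
    ((ContinuousLinearMap.apply ℂ E x).restrictScalars ℝ).hasFDerivAt
  exact h.comp_hasDerivAt r (hasDerivAt_expGroup T r)

lemma continuous_expGroup_apply (T : E →L[ℂ] E) (x : E) : Continuous fun r => expGroup T r x :=
  continuous_iff_continuousAt.2 fun r => (hasDerivAt_expGroup_apply T x r).continuousAt

/-- The smooth functional calculus of `T`, applied to the vector `x`. -/
noncomputable def smoothCalc (T : E →L[ℂ] E) (x : E) (g : ℝ → ℂ) : E :=
  ∫ r, 𝓕 g r • expGroup T r x

variable {T : E →L[ℂ] E} (hT : ∀ r, ‖expGroup T r‖ ≤ 1) (x : E) {g h : ℝ → ℂ}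

include hT

omit [CompleteSpace E] in
lemma norm_expGroup_apply_le (r : ℝ) : ‖expGroup T r x‖ ≤ ‖x‖ :=
  ((expGroup T r).le_of_opNorm_le (hT r) x).trans_eq (one_mul _)

lemma integrable_smul_expGroup {f : ℝ → ℂ} (hf : Integrable f) :
    Integrable fun r => f r • expGroup T r x := by
  refine Integrable.mono' (hf.norm.mul_const ‖x‖)
    (hf.1.smul (continuous_expGroup_apply T x).aestronglyMeasurable) (ae_of_all _ fun r => ?_)
  rw [norm_smul]
  gcongr
  exact norm_expGroup_apply_le hT x r

omit [CompleteSpace E] in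
lemma norm_smoothCalc_le (hg : IsTestFunction g) :
    ‖smoothCalc T x g‖ ≤ (∫ r, ‖𝓕 g r‖) * ‖x‖ := by
  rw [smoothCalc, ← integral_mul_const]
  refine norm_integral_le_of_norm_le (hg.integrable_fourier.norm.mul_const _)
    (ae_of_all _ fun r => ?_)
  rw [norm_smul]
  gcongr
  exact norm_expGroup_apply_le hT x r

lemma smoothCalc_mul_add (hg : IsTestFunction g) (hh : IsTestFunction h) (a : ℂ) :
    smoothCalc T x (fun l => a * g l + h l) = a • smoothCalc T x g + smoothCalc T x h := by
  have h1 := integrable_smul_expGroup hT x hg.integrable_fourier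
  have h2 := integrable_smul_expGroup hT x hh.integrable_fourier
  have h3 : Integrable fun r => a • 𝓕 g r • expGroup T r x := h1.smul a
  simp only [smoothCalc]
  rw [← integral_smul, ← integral_add h3 h2]
  congr 1
  ext r
  rw [hg.fourier_mul_add hh, add_smul, mul_smul]

lemma apply_smoothCalc (hg : IsTestFunction g) :
    T (smoothCalc T x g) = smoothCalc T x (fun l => (l : ℂ) * g l) := by
  have hg' := hg.mul_left IsTestFunction.contDiff_ofReal
  have i1 := integrable_smul_expGroup hT x hg.integrable_fourier
  have i2 := integrable_smul_expGroup hT x hg'.integrable_fourier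
  have j1 : Integrable fun r => (2 * Real.pi * Complex.I : ℂ) • 𝓕 g r • T (expGroup T r x) := by
    simpa only [map_smul] using (T.integrable_comp i1).fun_smul (2 * Real.pi * Complex.I : ℂ)
  have j2 : Integrable fun r => (-2 * Real.pi * Complex.I : ℂ) •
      𝓕 (fun l : ℝ => (l : ℂ) * g l) r • expGroup T r x := i2.smul _
  have key := integral_bilinear_hasDerivAt_right_eq_neg_left_of_integrable
    (L := ContinuousLinearMap.lsmul ℝ ℂ (E := E)) (u := 𝓕 g) (v := fun r => expGroup T r x)
    (fun r _ => hg.hasDerivAt_fourier r) (fun r _ => hasDerivAt_expGroup_apply T x r)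
    (by simpa only [ContinuousLinearMap.lsmul_apply,
      smul_comm _ (2 * Real.pi * Complex.I : ℂ)] using j1)
    (by simpa only [ContinuousLinearMap.lsmul_apply,
      mul_smul (-2 * Real.pi * Complex.I : ℂ)] using j2) i1
  simp only [ContinuousLinearMap.lsmul_apply, mul_smul (-2 * Real.pi * Complex.I : ℂ),
    integral_smul, smul_comm _ (2 * Real.pi * Complex.I : ℂ)] at key
  have h0 : (2 * Real.pi * Complex.I : ℂ) ≠ 0 := Complex.two_pi_I_ne_zero
  rw [smoothCalc, ← T.integral_comp_comm i1, smoothCalc]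
  simp only [map_smul]
  refine (smul_right_injective E h0) ?_
  simp only
  rw [key, neg_mul, neg_mul, neg_smul, neg_neg]

lemma sub_pow_apply_smoothCalc (hg : IsTestFunction g) (c : ℝ) (n : ℕ) :
    ((T - (c : ℂ) • 1) ^ n) (smoothCalc T x g) =
      smoothCalc T x (fun l => ((l : ℂ) - c) ^ n * g l) := by
  induction n with
  | zero => simp
  | succ n ih =>
    have h := hg.sub_pow_mul c n
    rw [pow_succ', mul_apply_eq_comp, ih]
    simp only [sub_apply, smul_apply, one_apply_eq_self]
    rw [apply_smoothCalc hT x h, sub_eq_neg_add, ← neg_smul,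
      ← smoothCalc_mul_add hT x h (h.mul_left IsTestFunction.contDiff_ofReal)]
    congr 1
    ext l
    ring

lemma exists_norm_sub_pow_apply_smoothCalc_le (hg : IsTestFunction g) {c ρ ρ' : ℝ} (hρ : 0 < ρ)
    (hρ' : ρ < ρ') (hs : ∀ l, g l ≠ 0 → |l - c| ≤ ρ) :
    ∃ A : ℝ, ∀ n : ℕ, ‖((T - (c : ℂ) • 1) ^ n) (smoothCalc T x g)‖ ≤ A * ρ' ^ n := by
  obtain ⟨A, hA⟩ := hg.exists_integral_norm_fourier_le hρ hρ' hs
  refine ⟨A * ‖x‖, fun n => ?_⟩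
  rw [sub_pow_apply_smoothCalc hT x hg]
  refine (norm_smoothCalc_le hT x (hg.sub_pow_mul c n)).trans ?_
  calc _ ≤ A * ρ' ^ n * ‖x‖ := by gcongr; exact hA n
    _ = _ := by ring

omit hT

/-- The vectors on which the powers of `T - c`, for some `c ≥ t`, grow at most like those of
`c - t`: the spectral subspace of `T` for the half-line `[t, ∞)`. -/
def growthSet (T : E →L[ℂ] E) (t : ℝ) : Set E :=
  {x | ∃ c A : ℝ, t ≤ c ∧ ∀ n : ℕ, ‖((T - (c : ℂ) • 1) ^ n) x‖ ≤ A * (c - t) ^ n}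

include hT

lemma smoothCalc_eq_zero_of_pos (h1 : ∀ y ∈ growthSet T 1, y = 0) (hg : IsTestFunction g)
    (hs : ∀ l, g l ≠ 0 → 2 ≤ l) : smoothCalc T x g = 0 := by
  obtain ⟨b, hb⟩ := hg.2.isBounded.subset_closedBall 0
  obtain ⟨A, hA⟩ := exists_norm_sub_pow_apply_smoothCalc_le hT x hg (c := |b| + 3)
    (ρ := |b| + 1) (ρ' := |b| + 3 - 1) (by positivity) (by linarith) fun l hl => by
      have h2 := hs l hl
      have h3 := hb (subset_tsupport _ hl)
      rw [mem_closedBall_zero_iff, Real.norm_eq_abs] at h3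
      have := le_abs_self b
      have := le_abs_self l
      rw [abs_le]
      constructor <;> linarith
  exact h1 _ ⟨|b| + 3, A, by linarith [abs_nonneg b], hA⟩

lemma smoothCalc_eq_zero_of_neg (h1 : ∀ y ∈ growthSet (-T) 1, y = 0) (hg : IsTestFunction g)
    (hs : ∀ l, g l ≠ 0 → l ≤ -2) : smoothCalc T x g = 0 := by
  obtain ⟨b, hb⟩ := hg.2.isBounded.subset_closedBall 0
  obtain ⟨A, hA⟩ := exists_norm_sub_pow_apply_smoothCalc_le hT x hg (c := -(|b| + 3))
    (ρ := |b| + 1) (ρ' := |b| + 3 - 1) (by positivity) (by linarith) fun l hl => by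
      have h2 := hs l hl
      have h3 := hb (subset_tsupport _ hl)
      rw [mem_closedBall_zero_iff, Real.norm_eq_abs] at h3
      have := le_abs_self b
      have := neg_abs_le l
      rw [abs_le]
      constructor <;> linarith
  refine h1 _ ⟨|b| + 3, A, by linarith [abs_nonneg b], fun n => ?_⟩
  have : -T - ((|b| + 3 : ℝ) : ℂ) • 1 = -(T - ((-(|b| + 3) : ℝ) : ℂ) • 1) := by
    rw [Complex.ofReal_neg, neg_smul]; abel
  rw [this, neg_pow]
  refine le_trans (le_of_eq ?_) (hA n)
  rcases neg_one_pow_eq_or (E →L[ℂ] E) n with h | h <;> rw [h] <;> simp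

omit hT

/-- A smooth cutoff function equal to `1` on `[-2, 2]`. -/
noncomputable def cutoff : ContDiffBump (0 : ℝ) := ⟨2, 3, by norm_num, by norm_num⟩

/-- The dilation of the cutoff function by the factor `R`. -/
noncomputable def dilatedCutoff (R : ℝ) (l : ℝ) : ℂ := (cutoff (l * R⁻¹) : ℝ)

lemma isTestFunction_dilatedCutoff {R : ℝ} (hR : 0 < R) : IsTestFunction (dilatedCutoff R) := by
  constructor
  · exact Complex.ofRealCLM.contDiff.comp (cutoff.contDiff.comp (contDiff_id.mul contDiff_const))
  · have h := cutoff.hasCompactSupport.comp_left (g := fun r : ℝ => (r : ℂ)) (by simp)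
    exact h.comp_homeomorph (Homeomorph.mulRight₀ R⁻¹ (by positivity))

lemma dilatedCutoff_eq_one {R l : ℝ} (hR : 1 ≤ R) (hl : |l| ≤ 2) : dilatedCutoff R l = 1 := by
  have : cutoff (l * R⁻¹) = 1 := by
    apply cutoff.one_of_mem_closedBall
    rw [mem_closedBall_zero_iff, Real.norm_eq_abs, abs_mul, abs_of_nonneg (by positivity : 0 ≤ R⁻¹)]
    have : R⁻¹ ≤ 1 := inv_le_one_of_one_le₀ hR
    have : |l| * R⁻¹ ≤ 2 * 1 := by gcongr
    simpa [cutoff] using this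
  simp [dilatedCutoff, this]

lemma fourier_dilatedCutoff {R : ℝ} (hR : 0 < R) (r : ℝ) :
    𝓕 (dilatedCutoff R) r = R * 𝓕 (dilatedCutoff 1) (R * r) := by
  rw [Real.fourier_real_eq, Real.fourier_real_eq]
  have := Measure.integral_comp_mul_right
    (fun l => Real.fourierChar (-(l * (R * r))) • dilatedCutoff 1 l) R⁻¹
  rw [inv_inv, abs_of_pos hR, Complex.real_smul] at this
  rw [← this]
  congr 1
  ext l
  have : l * R⁻¹ * (R * r) = l * r := by field_simp
  rw [this]
  simp [dilatedCutoff]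

include hT

lemma tendsto_smoothCalc_dilatedCutoff :
    Tendsto (fun n : ℕ => smoothCalc T x (dilatedCutoff (n + 1))) atTop (𝓝 x) := by
  have hφ := isTestFunction_dilatedCutoff one_pos
  have h1 (n : ℕ) : smoothCalc T x (dilatedCutoff (n + 1)) =
      ∫ r, 𝓕 (dilatedCutoff 1) r • expGroup T ((n + 1 : ℝ)⁻¹ * r) x := by
    have hn : (0 : ℝ) < n + 1 := by positivity
    have := Measure.integral_comp_mul_left
      (fun r => 𝓕 (dilatedCutoff 1) r • expGroup T ((n + 1 : ℝ)⁻¹ * r) x) (n + 1 : ℝ)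
    rw [abs_of_pos (by positivity), eq_inv_smul_iff₀ hn.ne'] at this
    rw [← this, smoothCalc, ← integral_smul]
    congr 1
    ext r
    rw [fourier_dilatedCutoff hn, mul_smul, inv_mul_cancel_left₀ hn.ne', ← Complex.coe_smul]
  have h2 : Tendsto (fun n : ℕ => ∫ r, 𝓕 (dilatedCutoff 1) r • expGroup T ((n + 1 : ℝ)⁻¹ * r) x)
      atTop (𝓝 (∫ r, 𝓕 (dilatedCutoff 1) r • x)) := by
    refine tendsto_integral_of_dominated_convergence (fun r => ‖𝓕 (dilatedCutoff 1) r‖ * ‖x‖)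
      (fun n => ?_) (hφ.integrable_fourier.norm.mul_const _)
      (fun n => ae_of_all _ fun r => ?_) (ae_of_all _ fun r => ?_)
    · exact (hφ.continuous_fourier.smul ((continuous_expGroup_apply T x).comp
        (continuous_const.mul continuous_id))).aestronglyMeasurable
    · rw [norm_smul]
      gcongr
      exact norm_expGroup_apply_le hT x _
    · refine Tendsto.const_smul ?_ _
      have h3 : Tendsto (fun n : ℕ => (n + 1 : ℝ)⁻¹ * r) atTop (𝓝 0) := by
        simpa [one_div] using (tendsto_one_div_add_atTop_nhds_zero_nat (𝕜 := ℝ)).mul_const r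
      have h4 := (continuous_expGroup_apply T x).tendsto 0
      rw [expGroup_zero] at h4
      exact h4.comp h3
  rw [integral_smul_const, hφ.integral_fourier, dilatedCutoff_eq_one le_rfl (by simp), one_smul]
    at h2
  simpa only [h1] using h2

lemma smoothCalc_cutoff_eq (h1 : ∀ y ∈ growthSet T 1, y = 0) (h2 : ∀ y ∈ growthSet (-T) 1, y = 0)
    {R : ℝ} (hR : 1 ≤ R) : smoothCalc T x (dilatedCutoff R) = smoothCalc T x (dilatedCutoff 1) := by
  have hφ := isTestFunction_dilatedCutoff one_pos
  have hd := (isTestFunction_dilatedCutoff (one_pos.trans_le hR)).sub hφ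
  set d : ℝ → ℂ := fun l => dilatedCutoff R l - dilatedCutoff 1 l with hd_def
  have hsupp (l : ℝ) (hl : |l| ≤ 2) : d l = 0 := by
    simp [hd_def, dilatedCutoff_eq_one hR hl, dilatedCutoff_eq_one le_rfl hl]
  have hσ : ContDiff ℝ ∞ fun l : ℝ => ((Real.smoothTransition l : ℝ) : ℂ) :=
    Complex.ofRealCLM.contDiff.comp Real.smoothTransition.contDiff
  have hp := hd.mul_left hσ
  have hm := hd.mul_left (contDiff_const (c := (1 : ℂ)).sub hσ)
  have zp := smoothCalc_eq_zero_of_pos hT x h1 hp fun l hl => by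
    by_contra! hlt
    rcases le_or_gt l 0 with h | h
    · exact hl (by simp [Real.smoothTransition.zero_of_nonpos h])
    · exact hl (by rw [hsupp l (by rw [abs_le]; constructor <;> linarith), mul_zero])
  have zm := smoothCalc_eq_zero_of_neg hT x h2 hm fun l hl => by
    by_contra! hlt
    rcases le_or_gt l 2 with h | h
    · exact hl (by rw [hsupp l (by rw [abs_le]; constructor <;> linarith), mul_zero])
    · exact hl (by simp [Real.smoothTransition.one_of_one_le (by linarith : 1 ≤ l)])
  have e1 := smoothCalc_mul_add hT x hp hm 1
  rw [zp, zm] at e1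
  have e2 := smoothCalc_mul_add hT x hφ hd 1
  have e3 : (fun l : ℝ => 1 * (((Real.smoothTransition l : ℝ) : ℂ) * d l) +
      (1 - ((Real.smoothTransition l : ℝ) : ℂ)) * d l) = d := by ext l; ring
  have e4 : (fun l : ℝ => 1 * dilatedCutoff 1 l + d l) = dilatedCutoff R := by
    ext l; simp [hd_def]
  rw [e3] at e1
  rw [e4, e1] at e2
  simpa using e2

omit hT

/-- A universal bound for the norm of operators with spectrum in `[-1, 1]` that generate a group of
contractions. -/
noncomputable def spectralConst : ℝ := ∫ r, ‖𝓕 (fun l : ℝ => (l : ℂ) * dilatedCutoff 1 l) r‖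

include hT in
theorem opNorm_le_spectralConst (h1 : ∀ y ∈ growthSet T 1, y = 0)
    (h2 : ∀ y ∈ growthSet (-T) 1, y = 0) : ‖T‖ ≤ spectralConst := by
  refine T.opNorm_le_bound (integral_nonneg fun _ => norm_nonneg _) fun x => ?_
  have hφ := isTestFunction_dilatedCutoff one_pos
  have h := tendsto_smoothCalc_dilatedCutoff hT x
  simp only [fun n : ℕ => smoothCalc_cutoff_eq hT x h1 h2 (by simp : (1 : ℝ) ≤ n + 1)] at h
  have hx : smoothCalc T x (dilatedCutoff 1) = x := tendsto_nhds_unique tendsto_const_nhds h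
  conv_lhs => rw [← hx, apply_smoothCalc hT x hφ]
  exact norm_smoothCalc_le hT x (hφ.mul_left IsTestFunction.contDiff_ofReal)

end BoundedGroup

section Uniqueness

variable {E : Type*} [NormedAddCommGroup E] [NormedSpace ℂ E] [CompleteSpace E]

lemma eq_expGroup_apply {T : E →L[ℂ] E} {u : ℝ → E}
    (hu : ∀ r, HasDerivAt u ((2 * Real.pi * Complex.I : ℂ) • T (u r)) r) (r : ℝ) :
    u r = expGroup T r (u 0) := by
  refine congrFun (ODE_solution_unique_univ (t₀ := 0) (s := fun _ => Set.univ)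
    (v := fun _ => ((2 * Real.pi * Complex.I : ℂ) • T)) (K := _) (fun _ =>
      ((2 * Real.pi * Complex.I : ℂ) • T).lipschitz.lipschitzOnWith) (fun t => ⟨hu t, trivial⟩)
    (fun t => ⟨hasDerivAt_expGroup_apply T (u 0) t, trivial⟩) ?_) r
  simp [expGroup_zero]

end Uniqueness

section GrowthSet

variable {E : Type*} [NormedAddCommGroup E] [NormedSpace ℂ E] {T : E →L[ℂ] E} {s t : ℝ} {x : E}

lemma growthSet_anti (h : s ≤ t) : growthSet T t ⊆ growthSet T s := by
  rintro x ⟨c, A, hc, hA⟩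
  refine ⟨c, A, h.trans hc, fun n => (hA n).trans ?_⟩
  have : 0 ≤ A := by simpa using (norm_nonneg _).trans (hA 0)
  have : 0 ≤ c - t := by linarith
  gcongr

lemma apply_mem_growthSet (h : x ∈ growthSet T t) : T x ∈ growthSet T t := by
  obtain ⟨c, A, hc, hA⟩ := h
  refine ⟨c, ‖T‖ * A, hc, fun n => ?_⟩
  have hcomm : Commute ((T - (c : ℂ) • 1) ^ n) T :=
    ((Commute.refl T).sub_left ((Commute.one_left T).smul_left _)).pow_left n
  have : ((T - (c : ℂ) • 1) ^ n) (T x) = T (((T - (c : ℂ) • 1) ^ n) x) :=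
    congrArg (fun S : E →L[ℂ] E => S x) hcomm.eq
  rw [this, mul_assoc]
  exact T.le_opNorm_of_le (hA n)

lemma eq_zero_of_mem_growthSet (ht : ‖T‖ < t) (h : x ∈ growthSet T t) : x = 0 := by
  obtain ⟨c, A, hc, hA⟩ := h
  have key (n : ℕ) : (c - ‖T‖) ^ n * ‖x‖ ≤ ‖((T - (c : ℂ) • 1) ^ n) x‖ := by
    induction n with
    | zero => simp
    | succ n ih =>
      rw [pow_succ', pow_succ', mul_apply_eq_comp]
      set z := ((T - (c : ℂ) • 1) ^ n) x
      have h1 : (T - (c : ℂ) • 1) z = T z - (c : ℂ) • z := by simp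
      have h2 : ‖(c : ℂ) • z‖ = c * ‖z‖ := by
        rw [norm_smul, Complex.norm_real, Real.norm_of_nonneg]
        linarith [norm_nonneg T]
      have h3 := norm_sub_norm_le ((c : ℂ) • z) (T z)
      rw [norm_sub_rev, ← h1, h2] at h3
      have h4 := T.le_opNorm z
      calc (c - ‖T‖) * (c - ‖T‖) ^ n * ‖x‖ = (c - ‖T‖) * ((c - ‖T‖) ^ n * ‖x‖) := by ring
        _ ≤ (c - ‖T‖) * ‖z‖ := by gcongr; linarith
        _ ≤ _ := by linarith
  have hpos : 0 < c - ‖T‖ := by linarith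
  have hq : (c - t) / (c - ‖T‖) < 1 := by rw [div_lt_one hpos]; linarith
  have hlim := (tendsto_pow_atTop_nhds_zero_of_lt_one (by
    apply div_nonneg <;> linarith : 0 ≤ (c - t) / (c - ‖T‖)) hq).const_mul A
  rw [mul_zero] at hlim
  refine norm_le_zero_iff.1 (ge_of_tendsto' hlim fun n => ?_)
  rw [div_pow, ← mul_div_assoc, le_div_iff₀ (by positivity), mul_comm]
  exact (key n).trans (hA n)

end GrowthSet

section Derivation

variable {N : Type*} [CStarAlgebra N]

/-- A bounded derivation which sends self-adjoint elements to skew-adjoint elements. -/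
structure IsHermitianDerivation (δ : N →L[ℂ] N) : Prop where
  leibniz (x y : N) : δ (x * y) = δ x * y + x * δ y
  map_star (x : N) : δ (star x) = -star (δ x)

lemma norm_le_one_of_star_eq_of_mul_self {p : N} (h1 : star p = p) (h2 : p * p = p) : ‖p‖ ≤ 1 := by
  have h := CStarRing.norm_star_mul_self (x := p)
  rw [h1, h2] at h
  nlinarith [norm_nonneg p]

/-- The bounded operator `x ↦ a * x - x * a`. -/
noncomputable def adL (a : N) : N →L[ℂ] N :=
  ContinuousLinearMap.mul ℂ N a - (ContinuousLinearMap.mul ℂ N).flip a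

@[simp] lemma adL_apply (a x : N) : adL a x = a * x - x * a := by simp [adL]

lemma mul_mem_growthSet {δ : N →L[ℂ] N} (hδ : ∀ x y, δ (x * y) = δ x * y + x * δ y) {s t : ℝ}
    {x y : N} (hx : x ∈ growthSet δ s) (hy : y ∈ growthSet δ t) : x * y ∈ growthSet δ (s + t) := by
  obtain ⟨c, A, hc, hA⟩ := hx
  obtain ⟨c', B, hc', hB⟩ := hy
  refine ⟨c + c', A * B, by linarith, fun n => ?_⟩
  induction n generalizing x y A B with
  | zero =>
    have hA0 := hA 0
    have hB0 := hB 0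
    simp only [pow_zero, one_apply_eq_self, mul_one] at hA0 hB0 ⊢
    exact (norm_mul_le _ _).trans
      (mul_le_mul hA0 hB0 (norm_nonneg _) ((norm_nonneg _).trans hA0))
  | succ n ih =>
    have h1 : (δ - ((c + c' : ℝ) : ℂ) • 1) (x * y) =
        (δ - (c : ℂ) • 1) x * y + x * (δ - (c' : ℂ) • 1) y := by
      simp only [sub_apply, smul_apply, one_apply_eq_self, hδ, sub_mul, mul_sub, smul_mul_assoc,
        mul_smul_comm, Complex.ofReal_add, add_smul]
      abel
    have hA' (k : ℕ) : ‖((δ - (c : ℂ) • 1) ^ k) ((δ - (c : ℂ) • 1) x)‖ ≤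
        A * (c - s) * (c - s) ^ k := by
      rw [← mul_apply_eq_comp, ← pow_succ, mul_assoc, ← pow_succ']
      exact hA _
    have hB' (k : ℕ) : ‖((δ - (c' : ℂ) • 1) ^ k) ((δ - (c' : ℂ) • 1) y)‖ ≤
        B * (c' - t) * (c' - t) ^ k := by
      rw [← mul_apply_eq_comp, ← pow_succ, mul_assoc, ← pow_succ']
      exact hB _
    rw [pow_succ, mul_apply_eq_comp, h1, map_add]
    refine (norm_add_le_of_le (ih _ hA' _ hB) (ih _ hA _ hB')).trans (le_of_eq ?_)
    ring

namespace IsHermitianDerivation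

variable {δ : N →L[ℂ] N} (hδ : IsHermitianDerivation δ)

include hδ

lemma expGroup_mul (r : ℝ) (x y : N) :
    expGroup δ r (x * y) = expGroup δ r x * expGroup δ r y := by
  have h := eq_expGroup_apply (T := δ) (u := fun r => expGroup δ r x * expGroup δ r y)
    (fun r => by
      have h1 := (hasDerivAt_expGroup_apply δ x r).mul (hasDerivAt_expGroup_apply δ y r)
      rwa [smul_mul_assoc, mul_smul_comm, ← smul_add, ← hδ.leibniz] at h1) r
  simpa [expGroup_zero] using h.symm

lemma expGroup_star (r : ℝ) (x : N) : expGroup δ r (star x) = star (expGroup δ r x) := by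
  have h := eq_expGroup_apply (T := δ) (u := fun r => star (expGroup δ r x))
    (fun r => by
      have h1 := (hasDerivAt_expGroup_apply δ x r).star
      convert h1 using 1
      rw [hδ.map_star, star_smul]
      simp) r
  simpa [expGroup_zero] using h.symm

lemma norm_expGroup_le_one (r : ℝ) : ‖expGroup δ r‖ ≤ 1 := by
  let φ : N →⋆ₙₐ[ℂ] N :=
    { toFun := expGroup δ r
      map_smul' := map_smul _
      map_zero' := map_zero _
      map_add' := map_add _
      map_mul' := hδ.expGroup_mul r
      map_star' := hδ.expGroup_star r }
  exact (expGroup δ r).opNorm_le_bound zero_le_one fun x =>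
    (NonUnitalStarAlgHom.norm_apply_le φ x).trans_eq (one_mul _).symm

lemma map_one : δ 1 = 0 := by
  have h := hδ.leibniz 1 1
  simpa using h

lemma one_mem_growthSet : (1 : N) ∈ growthSet δ 0 := by
  refine ⟨0, ‖(1 : N)‖, le_rfl, fun n => ?_⟩
  cases n with
  | zero => simp
  | succ n => simp [pow_succ, hδ.map_one]

lemma star_mem_growthSet {t : ℝ} {x : N} (hx : x ∈ growthSet (-δ) t) : star x ∈ growthSet δ t := by
  obtain ⟨c, A, hc, hA⟩ := hx
  refine ⟨c, A, hc, fun n => ?_⟩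
  have : ((δ - (c : ℂ) • 1) ^ n) (star x) = star (((-δ - (c : ℂ) • 1) ^ n) x) := by
    induction n with
    | zero => simp
    | succ n ih =>
      rw [pow_succ', pow_succ', mul_apply_eq_comp, mul_apply_eq_comp, ih]
      simp [hδ.map_star]
  rw [this, norm_star]
  exact hA n

lemma sub_adL {h : N} (hh : star h = h) : IsHermitianDerivation (δ - adL h) where
  leibniz x y := by
    simp only [sub_apply, adL_apply, hδ.leibniz]
    noncomm_ring
  map_star x := by
    simp only [sub_apply, adL_apply, hδ.map_star, star_sub, star_mul, hh]
    abel

lemma real_smul (c : ℝ) : IsHermitianDerivation ((c : ℂ) • δ) where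
  leibniz x y := by simp [hδ.leibniz]
  map_star x := by simp [hδ.map_star]

lemma map_eq_zero_of_annihilator {S : Set N} (hS : ∀ s ∈ S, δ s ∈ S) {p : N} (hp : star p = p)
    (hp' : p * p = p) (h : ∀ z, (∀ s ∈ S, z * s = 0) ↔ z * p = 0) : δ p = 0 := by
  have h1 : ∀ s ∈ S, (1 - p) * s = 0 := (h _).2 (by rw [sub_mul, one_mul, hp', sub_self])
  have h2 : δ p * p = 0 := (h _).1 fun s hs => by
    have h3 := hδ.leibniz (1 - p) s
    rw [h1 s hs, h1 _ (hS s hs), map_sub, hδ.map_one] at h3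
    simpa using h3.symm
  have h3 : p * δ p = 0 := by
    have := congrArg star h2
    have h4 := hδ.map_star p
    rw [hp] at h4
    rw [star_mul, hp, star_zero, ← neg_eq_zero, ← mul_neg, ← h4] at this
    exact this
  rw [← hp', hδ.leibniz, h2, h3, add_zero]

end IsHermitianDerivation

lemma mul_mul_mem_growthSet {δ : N →L[ℂ] N} {h q q' x : N} {j k t : ℝ}
    (hδ : ∀ x y, δ (x * y) = δ x * y + x * δ y) (hq : δ q = 0) (hq' : δ q' = 0)
    (hj : q * h = (j : ℂ) • q) (hk : h * q' = (k : ℂ) • q')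
    (hx : x ∈ growthSet (δ - adL h) t) : q * x * q' ∈ growthSet δ (t + (j - k)) := by
  obtain ⟨c, A, hc, hA⟩ := hx
  refine ⟨c + (j - k), ‖q‖ * A * ‖q'‖, by linarith, fun n => ?_⟩
  have key : ((δ - ((c + (j - k) : ℝ) : ℂ) • 1) ^ n) (q * x * q') =
      q * (((δ - adL h - (c : ℂ) • 1) ^ n) x) * q' := by
    clear hA
    induction n generalizing x with
    | zero => simp
    | succ n ih =>
      rw [pow_succ, pow_succ, mul_apply_eq_comp, mul_apply_eq_comp, ← ih]
      congr 1
      have e1 : q * (h * x) * q' = (j : ℂ) • (q * x * q') := by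
        rw [← mul_assoc, hj, smul_mul_assoc, smul_mul_assoc]
      have e2 : q * (x * h) * q' = (k : ℂ) • (q * x * q') := by
        rw [mul_assoc, mul_assoc, hk, mul_smul_comm, mul_smul_comm, mul_assoc]
      simp only [sub_apply, smul_apply, one_apply_eq_self, adL_apply, hδ, hq, hq', mul_sub,
        sub_mul, e1, e2, mul_smul_comm, smul_mul_assoc]
      push_cast
      simp only [add_smul, sub_smul]
      noncomm_ring
  rw [key, show c + (j - k) - (t + (j - k)) = c - t by ring]
  calc _ ≤ ‖q‖ * ‖((δ - adL h - (c : ℂ) • 1) ^ n) x‖ * ‖q'‖ := by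
        refine (norm_mul_le _ _).trans ?_
        gcongr
        exact norm_mul_le _ _
    _ ≤ ‖q‖ * (A * (c - t) ^ n) * ‖q'‖ := by gcongr; exact hA n
    _ = _ := by ring

end Derivation

section BoundedDerivation

variable {N : Type*} [CStarAlgebra N]

/-- Every left annihilator of a subset of `N` is the left annihilator of a projection. -/
def HasAnnihilatorProjections (N : Type*) [CStarAlgebra N] : Prop :=
  ∀ S : Set N, ∃ p : N, star p = p ∧ p * p = p ∧ ∀ z, (∀ s ∈ S, z * s = 0) ↔ z * p = 0

namespace IsHermitianDerivation

variable {δ : N →L[ℂ] N}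

lemma exists_norm_sub_adL_le_spectralConst (hN : HasAnnihilatorProjections N)
    (hδ : IsHermitianDerivation δ) {m : ℕ} (hm : ‖δ‖ < m) :
    ∃ h : N, star h = h ∧ ‖h‖ ≤ m ∧ ‖δ - adL h‖ ≤ spectralConst := by
  choose P hP1 hP2 hP3 using fun j : ℕ => hN (growthSet δ j)
  have hS (j : ℕ) (s : N) (hs : s ∈ growthSet δ j) : P j * s = s := by
    have := (hP3 j (1 - P j)).2 (by rw [sub_mul, one_mul, hP2, sub_self]) s hs
    rwa [sub_mul, one_mul, sub_eq_zero, eq_comm] at this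
  have hle {i j : ℕ} (hij : i ≤ j) : P i * P j = P j := by
    have := (hP3 j (1 - P i)).1 fun s hs => by
      rw [sub_mul, one_mul, hS i s (growthSet_anti (by exact_mod_cast hij) hs), sub_self]
    rwa [sub_mul, one_mul, sub_eq_zero, eq_comm] at this
  have hge {i j : ℕ} (hij : i ≤ j) : P j * P i = P j := by
    have := congrArg star (hle hij)
    rwa [star_mul, hP1, hP1] at this
  have hδP (j : ℕ) : δ (P j) = 0 :=
    hδ.map_eq_zero_of_annihilator (fun s hs => apply_mem_growthSet hs) (hP1 j) (hP2 j) (hP3 j)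
  have hP0 : P 0 = 1 := by
    simpa using hS 0 1 (by simpa using hδ.one_mem_growthSet)
  have hPm : P m = 0 := by
    simpa using (hP3 m 1).1 fun s hs => by rw [eq_zero_of_mem_growthSet hm hs, mul_zero]
  set Q : ℕ → N := fun j => P j - P (j + 1) with hQ
  have hQP {i j : ℕ} (hij : i ≤ j) : Q j * P i = Q j := by
    simp only [hQ, sub_mul, hge hij, hge (hij.trans j.le_succ)]
  have hQP' {i j : ℕ} (hij : j < i) : Q j * P i = 0 := by
    simp only [hQ, sub_mul, hle hij.le, hle (Nat.succ_le_of_lt hij), sub_self]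
  have hQs (j : ℕ) : star (Q j) = Q j := by simp only [hQ, star_sub, hP1]
  have hδQ (j : ℕ) : δ (Q j) = 0 := by simp only [hQ, map_sub, hδP, sub_self]
  set h : N := ∑ i ∈ Finset.range m, P (i + 1) with hh
  have hhs : star h = h := by simp only [hh, star_sum, hP1]
  have hQh {j : ℕ} (hj : j < m) : Q j * h = ((j : ℝ) : ℂ) • Q j := by
    rw [hh, Finset.mul_sum, ← Finset.sum_subset (Finset.range_mono hj.le) fun i _ hi =>
      hQP' (by rw [Finset.mem_range, not_lt] at hi; lia),
      Finset.sum_congr rfl fun i hi => hQP (Nat.succ_le_of_lt (Finset.mem_range.1 hi))]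
    simp [← Nat.cast_smul_eq_nsmul ℂ]
  have hhQ {j : ℕ} (hj : j < m) : h * Q j = ((j : ℝ) : ℂ) • Q j := by
    have := congrArg star (hQh hj)
    rw [star_mul, star_smul, hhs, hQs] at this
    simpa using this
  have hsum : ∑ j ∈ Finset.range m, Q j = 1 := by
    rw [Finset.sum_range_sub', hP0, hPm, sub_zero]
  have hδ' := hδ.sub_adL hhs
  have hzero (x : N) (hx : x ∈ growthSet (δ - adL h) 1) : x = 0 := by
    have hjk (j k : ℕ) (hj : j < m) (hk : k < m) : Q j * x * Q k = 0 := by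
      have hy := mul_mul_mem_growthSet hδ.leibniz (hδQ j) (hδQ k) (hQh hj) (hhQ hk) hx
      have hann : ∀ z ∈ growthSet δ k, Q j * x * Q k * z = 0 := fun z hz => by
        have hyz := mul_mem_growthSet hδ.leibniz hy hz
        rw [show (1 : ℝ) + (j - k) + k = ((j + 1 : ℕ) : ℝ) by push_cast; ring] at hyz
        have hPQ : P (j + 1) * Q j = 0 := by
          have := congrArg star (hQP' (Nat.lt_succ_self j))
          rwa [star_mul, hQs, hP1, star_zero] at this
        rw [← hS _ _ hyz]
        simp only [← mul_assoc, hPQ, zero_mul]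
      have := (hP3 k _).1 hann
      rwa [mul_assoc, hQP le_rfl] at this
    calc x = (∑ j ∈ Finset.range m, Q j) * x * ∑ k ∈ Finset.range m, Q k := by
          rw [hsum, one_mul, mul_one]
      _ = ∑ j ∈ Finset.range m, ∑ k ∈ Finset.range m, Q j * x * Q k := by
          rw [Finset.sum_mul, Finset.sum_mul_sum]
      _ = 0 := Finset.sum_eq_zero fun j hj => Finset.sum_eq_zero fun k hk =>
          hjk j k (Finset.mem_range.1 hj) (Finset.mem_range.1 hk)
  refine ⟨h, hhs, ?_, opNorm_le_spectralConst hδ'.norm_expGroup_le_one hzero fun x hx => ?_⟩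
  · refine (norm_sum_le_of_le _ fun i _ =>
      norm_le_one_of_star_eq_of_mul_self (hP1 (i + 1)) (hP2 (i + 1))).trans ?_
    simp
  · exact star_eq_zero.1 (hzero _ (hδ'.star_mem_growthSet hx))

lemma exists_norm_sub_adL_le_half (hN : HasAnnihilatorProjections N)
    (hδ : IsHermitianDerivation δ) :
    ∃ h : N, star h = h ∧ ‖h‖ ≤ 2 * ‖δ‖ ∧ ‖δ - adL h‖ ≤ ‖δ‖ / 2 := by
  rcases eq_or_ne δ 0 with rfl | hne
  · exact ⟨0, by simp, by simp, (norm_le_zero_iff.2 (by ext; simp)).trans (by simp)⟩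
  have hL : 0 < ‖δ‖ := norm_pos_iff.2 hne
  set K : ℝ := max spectralConst 1
  have hK : 1 ≤ K := le_max_right _ _
  set c : ℝ := 2 * K / ‖δ‖ with hc
  have hc0 : 0 < c := by positivity
  obtain ⟨m, hm1, hm2⟩ : ∃ m : ℕ, 2 * K < m ∧ m ≤ 4 * K := by
    refine ⟨⌊2 * K⌋₊ + 1, by exact_mod_cast Nat.lt_floor_add_one _, ?_⟩
    have := Nat.floor_le (by positivity : 0 ≤ 2 * K)
    push_cast
    linarith
  have hn : ‖(c : ℂ) • δ‖ < m := by
    rw [norm_smul, Complex.norm_real, Real.norm_of_nonneg hc0.le]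
    refine lt_of_eq_of_lt ?_ hm1
    rw [hc]; field_simp
  obtain ⟨h, h1, h2, h3⟩ := (hδ.real_smul c).exists_norm_sub_adL_le_spectralConst hN hn
  have hcinv : ‖((c⁻¹ : ℝ) : ℂ)‖ = c⁻¹ := by
    rw [Complex.norm_real, Real.norm_of_nonneg (by positivity)]
  refine ⟨((c⁻¹ : ℝ) : ℂ) • h, by simp [h1], ?_, ?_⟩
  · rw [norm_smul, hcinv]
    calc c⁻¹ * ‖h‖ ≤ c⁻¹ * (4 * K) := by gcongr; exact h2.trans hm2
      _ = 2 * ‖δ‖ := by rw [hc]; field_simp; ring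
  · have : δ - adL (((c⁻¹ : ℝ) : ℂ) • h) = ((c⁻¹ : ℝ) : ℂ) • ((c : ℂ) • δ - adL h) := by
      have h0 : (c : ℂ) ≠ 0 := by exact_mod_cast hc0.ne'
      ext x
      simp [smul_sub, smul_smul, h0]
    rw [this, norm_smul, hcinv]
    calc c⁻¹ * _ ≤ c⁻¹ * K := by gcongr; exact h3.trans (le_max_left _ _)
      _ = ‖δ‖ / 2 := by rw [hc]; field_simp

lemma exists_eq_adL (hN : HasAnnihilatorProjections N) (hδ : IsHermitianDerivation δ) :
    ∃ a : N, ‖a‖ ≤ 4 * ‖δ‖ ∧ ∀ x, δ x = a * x - x * a := by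
  have step (ε : N →L[ℂ] N) : ∃ h : N, IsHermitianDerivation ε →
      star h = h ∧ ‖h‖ ≤ 2 * ‖ε‖ ∧ ‖ε - adL h‖ ≤ ‖ε‖ / 2 := by
    by_cases hε : IsHermitianDerivation ε
    · exact (hε.exists_norm_sub_adL_le_half hN).imp fun h hh _ => hh
    · exact ⟨0, fun h => absurd h hε⟩
  choose f hf using step
  set ε : ℕ → N →L[ℂ] N := fun n => (fun ε => ε - adL (f ε))^[n] δ with hε_def
  have hsucc (n : ℕ) : ε (n + 1) = ε n - adL (f (ε n)) := Function.iterate_succ_apply' _ _ _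
  have hε (n : ℕ) : IsHermitianDerivation (ε n) ∧ ‖ε n‖ ≤ ‖δ‖ / 2 ^ n := by
    induction n with
    | zero => exact ⟨hδ, by simp [hε_def]⟩
    | succ n ih =>
      rw [hsucc]
      refine ⟨ih.1.sub_adL (hf _ ih.1).1, (hf _ ih.1).2.2.trans ?_⟩
      rw [pow_succ, ← div_div]
      have := ih.2
      gcongr
  have hbound (n : ℕ) : ‖f (ε n)‖ ≤ 4 * ‖δ‖ / 2 / 2 ^ n := by
    refine (hf _ (hε n).1).2.1.trans ?_
    have := (hε n).2
    calc 2 * ‖ε n‖ ≤ 2 * (‖δ‖ / 2 ^ n) := by gcongr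
      _ = _ := by ring
  have hs : Summable fun n => f (ε n) := (summable_geometric_two' _).of_norm_bounded hbound
  refine ⟨∑' n, f (ε n), tsum_of_norm_bounded (hasSum_geometric_two' _) hbound, fun x => ?_⟩
  have hpart (n : ℕ) : ε n x = δ x -
      ((∑ i ∈ Finset.range n, f (ε i)) * x - x * ∑ i ∈ Finset.range n, f (ε i)) := by
    induction n with
    | zero => simp [hε_def]
    | succ n ih =>
      rw [hsucc, sub_apply, ih, adL_apply, Finset.sum_range_succ]
      noncomm_ring
  have hlim := hs.hasSum.tendsto_sum_nat
  have h1 := ((hlim.mul_const x).sub (hlim.const_mul x)).const_sub (δ x)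
  simp only [← hpart] at h1
  have h2 : Tendsto (fun n => ε n x) atTop (𝓝 0) := by
    refine squeeze_zero_norm (a := fun n => ‖δ‖ * ‖x‖ * (1 / 2) ^ n) (fun n => ?_) ?_
    · refine ((ε n).le_of_opNorm_le (hε n).2 x).trans (le_of_eq ?_)
      rw [one_div, inv_pow]
      ring
    · simpa using (tendsto_pow_atTop_nhds_zero_of_lt_one (by norm_num : (0 : ℝ) ≤ 1 / 2)
        (by norm_num)).const_mul (‖δ‖ * ‖x‖)
  exact sub_eq_zero.1 (tendsto_nhds_unique h1 h2)

end IsHermitianDerivation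

/-- Kadison and Sakai: a bounded derivation is inner. -/
theorem exists_forall_eq_mul_sub_mul (hN : HasAnnihilatorProjections N) (δ : N →L[ℂ] N)
    (hδ : ∀ x y, δ (x * y) = δ x * y + x * δ y) :
    ∃ a : N, ‖a‖ ≤ 8 * ‖δ‖ ∧ ∀ x, δ x = a * x - x * a := by
  have hnorm (s : ℂ) (hs : ‖s‖ ≤ 1) (x : N) :
      ‖(2⁻¹ : ℂ) • (δ x + s • star (δ (star x)))‖ ≤ ‖δ‖ * ‖x‖ := by
    have h1 := δ.le_opNorm x
    have h2 : ‖s • star (δ (star x))‖ ≤ ‖δ‖ * ‖x‖ := by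
      rw [norm_smul, norm_star]
      have := δ.le_opNorm (star x)
      rw [norm_star] at this
      calc ‖s‖ * ‖δ (star x)‖ ≤ 1 * (‖δ‖ * ‖x‖) := by gcongr
        _ = _ := one_mul _
    rw [norm_smul, norm_inv, Complex.norm_ofNat]
    linarith [norm_add_le_of_le h1 h2]
  let half (s : ℂ) (hs : ‖s‖ ≤ 1) : N →L[ℂ] N := LinearMap.mkContinuous
    { toFun := fun x => (2⁻¹ : ℂ) • (δ x + s • star (δ (star x)))
      map_add' := fun x y => by simp only [star_add, map_add, smul_add]; abel
      map_smul' := fun c x => by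
        simp only [star_smul, map_smul, star_star, RingHom.id_apply, smul_add, smul_smul]
        congr 2 <;> ring } ‖δ‖ (hnorm s hs)
  have hle (s : ℂ) (hs : ‖s‖ ≤ 1) : ‖half s hs‖ ≤ ‖δ‖ :=
    LinearMap.mkContinuous_norm_le _ (norm_nonneg _) _
  have happ (s : ℂ) (hs : ‖s‖ ≤ 1) (x : N) :
    half s hs x = (2⁻¹ : ℂ) • (δ x + s • star (δ (star x))) := rfl
  have hleib (s : ℂ) (hs : ‖s‖ ≤ 1) (x y : N) :
      half s hs (x * y) = half s hs x * y + x * half s hs y := by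
    simp only [happ, star_mul, hδ, star_add, star_star, smul_mul_assoc, mul_smul_comm, ← smul_add,
      add_mul, mul_add]
    congr 1
    rw [smul_add]
    abel
  have hs1 : ‖(-1 : ℂ)‖ ≤ 1 := by simp
  have hs2 : ‖(1 : ℂ)‖ ≤ 1 := by simp
  have H1 : IsHermitianDerivation (half (-1) hs1) :=
    ⟨hleib (-1) hs1, fun x => by simp only [happ, star_star, star_smul, star_add]; simp⟩
  have H2 : IsHermitianDerivation (Complex.I • half 1 hs2) := by
    refine ⟨fun x y => ?_, fun x => ?_⟩
    · simp only [smul_apply, hleib, smul_add, smul_mul_assoc, mul_smul_comm]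
    · simp only [smul_apply, happ, star_star, star_smul, star_add]
      simp [add_comm]
  obtain ⟨a, ha, ha'⟩ := H1.exists_eq_adL hN
  obtain ⟨b, hb, hb'⟩ := H2.exists_eq_adL hN
  refine ⟨a - Complex.I • b, ?_, fun x => ?_⟩
  · have h1 : ‖Complex.I • b‖ ≤ 4 * ‖δ‖ := by
      rw [norm_smul, Complex.norm_I, one_mul]
      refine hb.trans ?_
      rw [norm_smul, Complex.norm_I, one_mul]
      gcongr
      exact hle 1 hs2
    have h2 : ‖a‖ ≤ 4 * ‖δ‖ := ha.trans (by gcongr; exact hle (-1) hs1)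
    linarith [norm_sub_le_of_le h2 h1]
  · have h1 := ha' x
    have h2 := congrArg (fun z => Complex.I • z) (hb' x)
    simp only [smul_apply, happ, smul_smul, one_smul, smul_sub]
      at h1 h2
    have h3 : δ x = (2⁻¹ : ℂ) • (δ x + (-1 : ℂ) • star (δ (star x))) -
        (-2⁻¹ : ℂ) • (δ x + star (δ (star x))) := by
      module
    have h4 : Complex.I * (Complex.I * 2⁻¹) = -2⁻¹ := by
      rw [← mul_assoc, Complex.I_mul_I, neg_one_mul]
    rw [h4] at h2
    rw [h3, h1, h2, sub_mul, mul_sub, smul_mul_assoc, mul_smul_comm]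
    abel

end BoundedDerivation

section AutomaticContinuity

variable {N H : Type*} [CStarAlgebra N] [NormedAddCommGroup H] [InnerProductSpace ℂ H]
  [CompleteSpace H]

lemma exists_isSelfAdjoint_mul_self_eq_norm_sq_sub {x : N} (hx : IsSelfAdjoint x) :
    ∃ y : N, IsSelfAdjoint y ∧ y * y = ((‖x‖ ^ 2 : ℝ) : ℂ) • 1 - x * x := by
  have hc1 : ContinuousOn (fun t : ℝ => √(‖x‖ ^ 2 - t ^ 2)) (spectrum ℝ x) := by fun_prop
  refine ⟨cfc (fun t : ℝ => √(‖x‖ ^ 2 - t ^ 2)) x, cfc_predicate _ _, ?_⟩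
  rw [← cfc_mul _ _ x hc1 hc1]
  have h1 : Set.EqOn (fun t : ℝ => √(‖x‖ ^ 2 - t ^ 2) * √(‖x‖ ^ 2 - t ^ 2))
      (fun t => ‖x‖ ^ 2 - t ^ 2) (spectrum ℝ x) := fun t ht => by
    refine Real.mul_self_sqrt (sub_nonneg.2 (sq_le_sq' ?_ ?_)) <;>
    · have := (spectrum.norm_le_norm_mul_of_mem ht)
      rcases subsingleton_or_nontrivial N with h | h
      · exact absurd ht (by simp [spectrum.of_subsingleton])
      · rw [norm_one, mul_one, Real.norm_eq_abs, abs_le] at this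
        linarith [this.1, this.2]
  rw [cfc_congr h1, cfc_sub _ _ x (by fun_prop) (by fun_prop), cfc_const _ x hx,
    cfc_pow_id x 2 hx, Algebra.algebraMap_eq_smul_one, sq x, Complex.coe_smul]

variable (π : N →⋆ₐ[ℂ] (H →L[ℂ] H)) (hπ : ∀ x, ‖π x‖ = ‖x‖) {D : N →ₗ[ℂ] N}
  (hD : ∀ x y, D (x * y) = D x * y + x * D y)

include hπ hD

lemma norm_le_norm_add_smul_of_map_star (hstar : ∀ x, D (star x) = star (D x)) {x : N}
    (hx : IsSelfAdjoint x) (c : ℝ) : ‖x‖ ≤ ‖x + (c : ℂ) • D x‖ := by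
  obtain ⟨y, hy, hxy⟩ := exists_isSelfAdjoint_mul_self_eq_norm_sq_sub hx
  have hsa (z : N) (hz : IsSelfAdjoint z) (v w : H) : inner ℂ (π z v) w = inner ℂ v (π z w) :=
    (hz.map π).isSymmetric v w
  have hDsa (z : N) (hz : IsSelfAdjoint z) : IsSelfAdjoint (D z) := by
    rw [IsSelfAdjoint, ← hstar, hz.star_eq]
  have hD1 : D 1 = 0 := by simpa using hD 1 1
  have hsum : D x * x + x * D x = -(D y * y + y * D y) := by
    have h := congrArg D hxy
    rw [map_sub, map_smul, hD1, smul_zero, zero_sub, hD, hD] at h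
    rw [h, neg_neg]
  have hre (z : N) (hz : IsSelfAdjoint z) (v : H) :
      inner ℂ v (π (D z * z + z * D z) v) = ((2 * (inner ℂ (π (D z) v) (π z v)).re : ℝ) : ℂ) := by
    rw [map_add, map_mul, map_mul, add_apply, mul_apply_eq_comp, mul_apply_eq_comp, inner_add_right,
      ← hsa (D z) (hDsa z hz) v, ← hsa z hz v, ← inner_conj_symm (π z v)]
    exact Complex.add_conj _
  rcases (norm_nonneg x).eq_or_lt with h0 | h0
  · rw [← h0]; exact norm_nonneg _
  have key (r : ℝ) (hr : 0 ≤ r) (hrx : r < ‖x‖) :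
      r ^ 2 - |c| * (‖D y‖ * √(‖x‖ ^ 2 - r ^ 2)) ≤ ‖x + (c : ℂ) • D x‖ * ‖x‖ := by
    obtain ⟨v, hv, hrv⟩ := (π x).exists_lt_apply_of_lt_opNorm (by rwa [hπ])
    have happ (z : N) : ‖π z v‖ ≤ ‖z‖ := by
      have := (π z).le_opNorm v
      rw [hπ] at this
      exact this.trans (mul_le_of_le_one_right (norm_nonneg _) hv.le)
    have hyv : ‖π y v‖ ≤ √(‖x‖ ^ 2 - r ^ 2) := by
      refine Real.le_sqrt_of_sq_le ?_
      have h1 : inner ℂ v (π (y * y) v) = inner ℂ v (π (((‖x‖ ^ 2 : ℝ) : ℂ) • 1 - x * x) v) := by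
        rw [hxy]
      rw [map_sub, map_smul, map_one, map_mul, map_mul, sub_apply, smul_apply, one_apply_eq_self,
        mul_apply_eq_comp, mul_apply_eq_comp, inner_sub_right, inner_smul_right, ← hsa y hy,
        ← hsa x hx, inner_self_eq_norm_sq_to_K, inner_self_eq_norm_sq_to_K,
        inner_self_eq_norm_sq_to_K] at h1
      have h2 : ‖π y v‖ ^ 2 = ‖x‖ ^ 2 * ‖v‖ ^ 2 - ‖π x v‖ ^ 2 := by
        apply Complex.ofReal_injective
        push_cast at h1 ⊢
        exact h1
      have h3 : ‖v‖ ^ 2 ≤ 1 := pow_le_one₀ (norm_nonneg _) hv.le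
      nlinarith [sq_nonneg ‖x‖]
    have h2 : (inner ℂ (π (D x) v) (π x v)).re = -(inner ℂ (π (D y) v) (π y v)).re := by
      have h3 := hre x hx v
      rw [hsum, map_neg, neg_apply, inner_neg_right, hre y hy, ← Complex.ofReal_neg] at h3
      have h4 := Complex.ofReal_injective h3
      linarith
    have h3 : |(inner ℂ (π (D x) v) (π x v)).re| ≤ ‖D y‖ * √(‖x‖ ^ 2 - r ^ 2) := by
      rw [h2, abs_neg]
      refine (Complex.abs_re_le_norm _).trans ((norm_inner_le_norm _ _).trans ?_)
      gcongr
      exact happ _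
    have h4 : (inner ℂ (π (x + (c : ℂ) • D x) v) (π x v)).re =
        ‖π x v‖ ^ 2 + c * (inner ℂ (π (D x) v) (π x v)).re := by
      rw [map_add, map_smul, add_apply, smul_apply, inner_add_left, inner_smul_left,
        inner_self_eq_norm_sq_to_K, Complex.conj_ofReal, Complex.add_re, Complex.re_ofReal_mul]
      norm_cast
    have h5 : (inner ℂ (π (x + (c : ℂ) • D x) v) (π x v)).re ≤ ‖x + (c : ℂ) • D x‖ * ‖x‖ := by
      refine (Complex.re_le_norm _).trans ((norm_inner_le_norm _ _).trans ?_)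
      gcongr <;> exact happ _
    have h6 : |c * (inner ℂ (π (D x) v) (π x v)).re| ≤ |c| * (‖D y‖ * √(‖x‖ ^ 2 - r ^ 2)) := by
      rw [abs_mul]
      gcongr
    have h7 := neg_abs_le (c * (inner ℂ (π (D x) v) (π x v)).re)
    have h8 : r ^ 2 ≤ ‖π x v‖ ^ 2 := by gcongr
    linarith
  have hlim : Tendsto (fun r : ℝ => r ^ 2 - |c| * (‖D y‖ * √(‖x‖ ^ 2 - r ^ 2))) (𝓝[<] ‖x‖)
      (𝓝 (‖x‖ ^ 2 - |c| * (‖D y‖ * √(‖x‖ ^ 2 - ‖x‖ ^ 2)))) :=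
    (Continuous.tendsto (by fun_prop) _).mono_left nhdsWithin_le_nhds
  have h := le_of_tendsto hlim (by
    filter_upwards [Ioo_mem_nhdsLT h0] with r hr using key r hr.1.le hr.2)
  rw [sub_self, Real.sqrt_zero, mul_zero, mul_zero, sub_zero, sq] at h
  exact le_of_mul_le_mul_right h h0

lemma continuous_of_leibniz_of_map_star (hstar : ∀ x, D (star x) = star (D x)) :
    Continuous D := by
  have claim (w : ℕ → N) (b : N) (hw : ∀ n, IsSelfAdjoint (w n)) (h0 : Tendsto w atTop (𝓝 0))
      (hb : Tendsto (fun n => D (w n)) atTop (𝓝 b)) : b = 0 := by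
    have hbs : star b = b := by
      refine tendsto_nhds_unique (hb.star.congr fun n => ?_) hb
      rw [← hstar, (hw n).star_eq]
    have h1 (c : ℝ) (hc : 0 < c) : ‖-b‖ ≤ ‖-b + (c : ℂ) • D (-b) + b‖ := by
      have h2 (n : ℕ) := norm_le_norm_add_smul_of_map_star π hπ hD hstar
        (x := -b + ((c⁻¹ : ℝ) : ℂ) • w n) (by
          rw [IsSelfAdjoint, star_add, star_neg, star_smul, (hw n).star_eq, hbs]; simp) c
      have h3 : Tendsto (fun n => -b + ((c⁻¹ : ℝ) : ℂ) • w n) atTop (𝓝 (-b)) := by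
        simpa using (h0.const_smul ((c⁻¹ : ℝ) : ℂ)).const_add (-b)
      refine le_of_tendsto_of_tendsto' h3.norm ?_ h2
      refine (((h3.add_const ((c : ℂ) • D (-b))).add hb).congr fun n => ?_).norm
      have hc' : (c : ℂ) ≠ 0 := by exact_mod_cast hc.ne'
      rw [map_add, map_smul, smul_add, smul_smul, Complex.ofReal_inv, mul_inv_cancel₀ hc', one_smul]
      abel
    have h4 : Tendsto (fun c : ℝ => ‖-b + (c : ℂ) • D (-b) + b‖) (𝓝[>] 0) (𝓝 0) := by
      have : Tendsto (fun c : ℝ => ‖-b + (c : ℂ) • D (-b) + b‖) (𝓝 0)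
          (𝓝 ‖-b + ((0 : ℝ) : ℂ) • D (-b) + b‖) := Continuous.tendsto (by fun_prop) 0
      simp only [Complex.ofReal_zero, zero_smul, add_zero, neg_add_cancel, norm_zero] at this
      exact this.mono_left nhdsWithin_le_nhds
    have h5 := ge_of_tendsto h4 (by filter_upwards [self_mem_nhdsWithin] with c hc using h1 c hc)
    simpa using h5
  refine D.continuous_of_seq_closed_graph fun u x y hu hy => ?_
  have hv : Tendsto (fun n => u n - x) atTop (𝓝 0) := by simpa using hu.sub_const x
  have hDv : Tendsto (fun n => D (u n - x)) atTop (𝓝 (y - D x)) := by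
    simpa using hy.sub_const (D x)
  have h1 := claim (fun n => (u n - x) + star (u n - x)) ((y - D x) + star (y - D x))
    (fun n => IsSelfAdjoint.add_star_self _) (by simpa using hv.add hv.star)
    (by simpa only [map_add, hstar] using hDv.add hDv.star)
  have h2 := claim (fun n => Complex.I • ((u n - x) - star (u n - x)))
    (Complex.I • ((y - D x) - star (y - D x)))
    (fun n => by rw [IsSelfAdjoint, star_smul, star_sub, star_star]; simp [smul_sub]; abel)
    (by simpa using (hv.sub hv.star).const_smul Complex.I)
    (by simpa only [map_sub, map_smul, hstar] using (hDv.sub hDv.star).const_smul Complex.I)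
  have h3 := (smul_eq_zero_iff_right Complex.I_ne_zero).1 h2
  have h4 : (2 : ℂ) • (y - D x) = 0 := by
    calc (2 : ℂ) • (y - D x) =
        ((y - D x) + star (y - D x)) + ((y - D x) - star (y - D x)) := by rw [two_smul]; abel
      _ = 0 := by rw [h1, h3, add_zero]
  exact sub_eq_zero.1 ((smul_eq_zero_iff_right two_ne_zero).1 h4)

/-- Derivations are automatically continuous. -/
theorem continuous_of_leibniz : Continuous D := by
  let half (s : ℂ) : N →ₗ[ℂ] N :=
    { toFun := fun x => s • D x + star (s • D (star x))
      map_add' := fun x y => by simp only [star_add, map_add, smul_add]; abel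
      map_smul' := fun c x => by
        simp only [star_smul, map_smul, RingHom.id_apply, smul_add, smul_smul]
        congr 2 <;> simp [mul_comm] }
  have happ (s : ℂ) (x : N) : half s x = s • D x + star (s • D (star x)) := rfl
  have hcont (s : ℂ) : Continuous (half s) := by
    refine continuous_of_leibniz_of_map_star π hπ (fun x y => ?_) fun x => ?_
    · simp only [happ, star_mul, hD, star_add, star_smul, star_star, add_mul, mul_add, smul_add,
        smul_mul_assoc, mul_smul_comm]
      abel
    · simp only [happ, star_add, star_star, add_comm]
  have h : (D : N → N) = fun x => (2⁻¹ : ℂ) • (half 1 x - Complex.I • half Complex.I x) := by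
    ext x
    simp only [happ, smul_add, star_smul, smul_smul, one_smul, Complex.I_mul_I]
    simp
    module
  rw [h]
  have h1 := hcont 1
  have h2 := hcont Complex.I
  fun_prop

end AutomaticContinuity

namespace VonNeumannAlgebra

variable {H : Type*} [NormedAddCommGroup H] [InnerProductSpace ℂ H] [CompleteSpace H]

instance isClosed_toStarSubalgebra (M : VonNeumannAlgebra H) :
    IsClosed (M.toStarSubalgebra : Set (H →L[ℂ] H)) := by
  rw [coe_toStarSubalgebra, ← M.centralizer_centralizer]
  exact Set.isClosed_centralizer _

lemma hasAnnihilatorProjections (M : VonNeumannAlgebra H) :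
    HasAnnihilatorProjections M.toStarSubalgebra := by
  intro S
  set U : Submodule ℂ H :=
    (⨆ s ∈ S, (s : H →L[ℂ] H).range).topologicalClosure with hU
  have : CompleteSpace U := (Submodule.isClosed_topologicalClosure _).completeSpace_coe
  have hSU (s : M.toStarSubalgebra) (hs : s ∈ S) (v : H) : (s : H →L[ℂ] H) v ∈ U :=
    Submodule.le_topologicalClosure _
      (Submodule.mem_iSup_of_mem s (Submodule.mem_iSup_of_mem hs ⟨v, rfl⟩))
  have hUle (V : Submodule ℂ H) (hV : IsClosed (V : Set H))
      (h : ∀ s ∈ S, ∀ v, (s : H →L[ℂ] H) v ∈ V) : U ≤ V := by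
    refine Submodule.topologicalClosure_minimal _ (iSup₂_le fun s hs => ?_) hV
    rintro _ ⟨v, rfl⟩
    exact h s hs v
  have hp : IsStarProjection U.starProjection := isStarProjection_starProjection
  have hpM : U.starProjection ∈ M := by
    rw [IsStarProjection.mem_iff hp]
    intro y hy
    rw [Submodule.range_starProjection, Module.End.mem_invtSubmodule]
    refine hUle _ ((Submodule.isClosed_topologicalClosure _).preimage y.continuous)
      fun s hs v => ?_
    have h := congrArg (fun T : H →L[ℂ] H => T v) (mem_commutant_iff.1 hy s s.2)
    change y ((s : H →L[ℂ] H) v) ∈ U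
    rw [← mul_apply_eq_comp, ← h]
    exact hSU s hs (y v)
  refine ⟨⟨U.starProjection, hpM⟩, Subtype.ext hp.isSelfAdjoint.star_eq,
    Subtype.ext hp.isIdempotentElem.eq, fun z => ⟨fun h => ?_, fun h s hs => ?_⟩⟩
  · have hker : U ≤ (z : H →L[ℂ] H).ker :=
      hUle _ (z : H →L[ℂ] H).isClosed_ker fun s hs v =>
        congrArg (fun T : M.toStarSubalgebra => (T : H →L[ℂ] H) v) (h s hs)
    ext v
    exact hker (U.starProjection_apply_mem v)
  · ext v
    have h1 := congrArg (fun T : M.toStarSubalgebra => (T : H →L[ℂ] H) ((s : H →L[ℂ] H) v)) h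
    have h2 := U.starProjection_eq_self_iff.2 (hSU s hs v)
    change (z : H →L[ℂ] H) (U.starProjection ((s : H →L[ℂ] H) v)) = 0 at h1
    rw [h2] at h1
    exact h1

/-- Every derivation of a von Neumann algebra is inner, and is implemented by an element whose norm
is controlled by the value of the derivation at a single element of the unit ball. -/
theorem exists_forall_eq_mul_sub_mul (M : VonNeumannAlgebra H)
    (D : M.toStarSubalgebra →ₗ[ℂ] M.toStarSubalgebra)
    (hD : ∀ x y, D (x * y) = D x * y + x * D y) :
    ∃ a x : M.toStarSubalgebra, ‖x‖ ≤ 1 ∧ ‖a‖ ≤ 16 * ‖D x‖ ∧ ∀ y, D y = a * y - y * a := by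
  let δ : M.toStarSubalgebra →L[ℂ] M.toStarSubalgebra :=
    ⟨D, continuous_of_leibniz M.toStarSubalgebra.subtype (fun _ => rfl) hD⟩
  obtain ⟨a, ha, ha'⟩ := _root_.exists_forall_eq_mul_sub_mul M.hasAnnihilatorProjections δ hD
  rcases (norm_nonneg δ).eq_or_lt with h0 | h0
  · exact ⟨a, 0, by simp, by rw [← h0] at ha; simpa using ha, ha'⟩
  · obtain ⟨x, hx, hδx⟩ := δ.exists_lt_apply_of_lt_opNorm (half_lt_self h0)
    refine ⟨a, x, hx.le, ha.trans ?_, ha'⟩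
    change ‖δ‖ / 2 < ‖D x‖ at hδx
    linarith

end VonNeumannAlgebra

end

set_option synthInstance.maxHeartbeats 1000000
set_option maxHeartbeats 1000000

/-- Let `M n` be a von Neumann algebra on a complex Hilbert
space `H n` for each `n`, and let
`A = { (x_n) : ∀ p ≥ 1, ∑ n, 2⁻ⁿ ‖x_n‖ᵖ < ∞ }`, a *-subalgebra of the product
`∏ n, M n` under coordinatewise operations. Then every derivation `D` on `A`
is inner: there is `a ∈ A` with `D x = a x - x a` for all `x ∈ A`. -/
theorem derivation_on_weighted_product_inner
    (H : ℕ → Type*) [∀ n, NormedAddCommGroup (H n)] [∀ n, InnerProductSpace ℂ (H n)]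
    [∀ n, CompleteSpace (H n)]
    (M : ∀ n, VonNeumannAlgebra (H n))
    (A : Set (∀ n, (M n).toStarSubalgebra))
    (hA : A = {x : ∀ n, (M n).toStarSubalgebra |
      ∀ p : ℝ, 1 ≤ p → Summable fun n => ((2 : ℝ) ^ n)⁻¹ * ‖x n‖ ^ p})
    (D : (∀ n, (M n).toStarSubalgebra) → ∀ n, (M n).toStarSubalgebra)
    (hmap : ∀ x ∈ A, D x ∈ A)
    (hadd : ∀ x ∈ A, ∀ y ∈ A, D (x + y) = D x + D y)
    (hsmul : ∀ (c : ℂ), ∀ x ∈ A, D (c • x) = c • D x)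
    (hleib : ∀ x ∈ A, ∀ y ∈ A, D (x * y) = D x * y + x * D y) :
    ∃ a ∈ A, ∀ x ∈ A, D x = a * x - x * a := by
  subst hA
  have hsingle (n : ℕ) (y : (M n).toStarSubalgebra) : Pi.single n y ∈
      {x : ∀ n, (M n).toStarSubalgebra |
        ∀ p : ℝ, 1 ≤ p → Summable fun n => ((2 : ℝ) ^ n)⁻¹ * ‖x n‖ ^ p} := fun p hp =>
    summable_of_ne_finset_zero (s := {n}) fun m hm => by
      rw [Finset.mem_singleton] at hm
      rw [Pi.single_eq_of_ne hm, norm_zero, Real.zero_rpow (by linarith), mul_zero]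
  have hcoord (n : ℕ) (x) (hx : x ∈ {x : ∀ n, (M n).toStarSubalgebra |
      ∀ p : ℝ, 1 ≤ p → Summable fun n => ((2 : ℝ) ^ n)⁻¹ * ‖x n‖ ^ p}) :
      D x n = D (Pi.single n (x n)) n := by
    have h1 := congrFun (hleib _ (hsingle n 1) _ (hsingle n 1)) n
    rw [← Pi.single_mul, Pi.add_apply, Pi.mul_apply, Pi.mul_apply, Pi.single_eq_same, mul_one,
      mul_one, one_mul, left_eq_add] at h1
    have h2 := congrFun (hleib _ (hsingle n 1) x hx) n
    have h3 : Pi.single n 1 * x = Pi.single n (x n) := by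
      ext1 m
      rcases eq_or_ne m n with rfl | h
      · simp
      · simp [Pi.single_eq_of_ne h]
    rw [Pi.add_apply, Pi.mul_apply, Pi.mul_apply, Pi.single_eq_same, one_mul, h1, zero_mul,
      zero_add, h3] at h2
    exact h2.symm
  let d (n : ℕ) : (M n).toStarSubalgebra →ₗ[ℂ] (M n).toStarSubalgebra :=
    { toFun := fun y => D (Pi.single n y) n
      map_add' := fun y z => by
        rw [Pi.single_add, hadd _ (hsingle n y) _ (hsingle n z), Pi.add_apply]
      map_smul' := fun c y => by
        rw [Pi.single_smul, hsmul c _ (hsingle n y), Pi.smul_apply, RingHom.id_apply] }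
  have hd (n : ℕ) (y z : (M n).toStarSubalgebra) : d n (y * z) = d n y * z + y * d n z := by
    change D (Pi.single n (y * z)) n = D (Pi.single n y) n * z + y * D (Pi.single n z) n
    rw [Pi.single_mul, hleib _ (hsingle n y) _ (hsingle n z), Pi.add_apply, Pi.mul_apply,
      Pi.mul_apply, Pi.single_eq_same, Pi.single_eq_same]
  choose a x hx ha hinner using fun n => (M n).exists_forall_eq_mul_sub_mul (d n) (hd n)
  have hgeom : Summable fun n : ℕ => ((2 : ℝ) ^ n)⁻¹ := by
    simpa [one_div, inv_pow] using summable_geometric_two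
  have hxA : x ∈ {x : ∀ n, (M n).toStarSubalgebra |
      ∀ p : ℝ, 1 ≤ p → Summable fun n => ((2 : ℝ) ^ n)⁻¹ * ‖x n‖ ^ p} := fun p hp =>
    hgeom.of_nonneg_of_le (fun n => by positivity) fun n =>
      mul_le_of_le_one_right (by positivity)
        (Real.rpow_le_one (norm_nonneg _) (hx n) (by linarith))
  refine ⟨a, fun p hp => ?_, fun y hy => ?_⟩
  · refine ((hmap x hxA p hp).mul_left ((16 : ℝ) ^ p)).of_nonneg_of_le (fun n => by positivity)
      fun n => ?_
    have h1 : ‖a n‖ ≤ 16 * ‖D x n‖ := by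
      rw [hcoord n x hxA]
      exact ha n
    calc ((2 : ℝ) ^ n)⁻¹ * ‖a n‖ ^ p ≤ ((2 : ℝ) ^ n)⁻¹ * (16 * ‖D x n‖) ^ p := by gcongr
      _ = _ := by rw [Real.mul_rpow (by norm_num) (norm_nonneg _)]; ring
  · ext1 n
    rw [hcoord n y hy]
    exact hinner n (y n)
end
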